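/- Let H:ℝ→[0,∞) be a symmetric convex function with H(x)=x²/4 for |x|≤2t₀ for some t₀>0, whose Fenchel–Legendre transform H*(x)=sup_y(xy−H(y)) satisfies lim_{x→∞}H*(x)/x=∞, and suppose there exist A∈[1,∞) and α∈(1,2] such that H(sx)≤A s^α H(x) for all x∈ℝ and s∈[0,1]. Set θ(t)=H*(t) for t≥0. Then for any Borel probability measure μ on ℝ the following are equivalent: (i) for every s>0 we have ∫_ℝ e^{s|x|} dμ(x)<∞ and there exists c>0 such that Ent_μ(e^φ) ≤ ∫_ℝ H(c φ′) e^φ dμ for every smooth convex Lipschitz function φ:ℝ→ℝ; (ii) there exists b>0 such that for all h>0, Δ_μ(h) ≤ (1/b)·θ^{-1}(t₀²+h). -/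

import Mathlib

open MeasureTheory ProbabilityTheory Real Set Filter Topology
open scoped ENNReal NNReal

/-- The generalized inverse `F_μ^{-1}(t) = inf {y : F_μ(y) ≥ t}` of the cumulative
distribution function `F_μ(y) = μ((-∞, y])`. -/
noncomputable def invCDF (μ : Measure ℝ) (t : ℝ) : ℝ :=
  sInf {y : ℝ | t ≤ (μ (Iic y)).toReal}

/-- The cumulative distribution function of the symmetric exponential measure `τ`
with density `(1/2) e^{-|x|}`. -/
noncomputable def expCDF (x : ℝ) : ℝ :=
  if x < 0 then Real.exp x / 2 else 1 - Real.exp (-x) / 2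

/-- `U_μ = F_μ^{-1} ∘ F_τ`, the unique left-continuous non-decreasing map
transporting `τ` onto `μ`. -/
noncomputable def Umap (μ : Measure ℝ) (x : ℝ) : ℝ :=
  invCDF μ (expCDF x)

open scoped Classical in
/-- `Ent_μ(g) = ∫ g ln g dμ − (∫ g dμ) ln (∫ g dμ)` if `∫ g ln g dμ < ∞`, and `+∞`
otherwise (for nonnegative `g` this quantity is nonnegative, so it is recorded in `ℝ≥0∞`). -/
noncomputable def Ent (μ : Measure ℝ) (g : ℝ → ℝ) : ℝ≥0∞ :=
  if Integrable (fun x => g x * Real.log (g x)) μ then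
    ENNReal.ofReal ((∫ x, g x * Real.log (g x) ∂μ) -
      (∫ x, g x ∂μ) * Real.log (∫ x, g x ∂μ))
  else ⊤

open scoped Classical in
/-- The relative entropy `H(ν|μ) = ∫ log (dν/dμ) dν`, `+∞` if `ν` is not absolutely
continuous w.r.t. `μ` (for probability measures it is nonnegative, hence valued in `ℝ≥0∞`). -/
noncomputable def relEnt {α : Type*} [MeasurableSpace α] (ν μ : Measure α) : ℝ≥0∞ :=
  if ν ≪ μ ∧ Integrable (fun x => Real.log ((ν.rnDeriv μ x).toReal)) ν then
    ENNReal.ofReal (∫ x, Real.log ((ν.rnDeriv μ x).toReal) ∂ν)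
  else ⊤

/-- The weak (barycentric) transport cost
`T̄_θ(μ₂|μ₁) = inf_π ∫ θ(|x − ∫ y p(x,dy)|) μ₁(dx)`, the infimum running over all
couplings `π(dxdy) = p(x,dy) μ₁(dx)` of `μ₁` and `μ₂` (described by their
disintegration kernels `p`). -/
noncomputable def weakCost (θ : ℝ → ℝ) (μ₂ μ₁ : Measure ℝ) : ℝ≥0∞ :=
  ⨅ (p : Kernel ℝ ℝ) (_ : IsMarkovKernel p) (_ : μ₁.bind (fun x => p x) = μ₂),
    ∫⁻ x, ENNReal.ofReal (θ |x - ∫ y, y ∂(p x)|) ∂μ₁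

/-- `μ` satisfies `T̄⁻(θ)`: `T̄_θ(μ|ν) ≤ H(ν|μ)` for every probability measure `ν`
with finite first moment. -/
def Tminus (θ : ℝ → ℝ) (μ : Measure ℝ) : Prop :=
  ∀ ν : Measure ℝ, IsProbabilityMeasure ν → Integrable (fun x => x) ν →
    weakCost θ μ ν ≤ relEnt ν μ

/-- `μ` satisfies `T̄⁺(θ)`: `T̄_θ(ν|μ) ≤ H(ν|μ)` for every probability measure `ν`
with finite first moment. -/
def Tplus (θ : ℝ → ℝ) (μ : Measure ℝ) : Prop :=
  ∀ ν : Measure ℝ, IsProbabilityMeasure ν → Integrable (fun x => x) ν →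
    weakCost θ ν μ ≤ relEnt ν μ

/-- The inverse of an increasing cost function `θ` on `[0,∞)`:
`θ⁻¹(u) = inf {t ≥ 0 : θ(t) ≥ u}`. -/
noncomputable def cinv (θ : ℝ → ℝ) (u : ℝ) : ℝ :=
  sInf {t : ℝ | 0 ≤ t ∧ u ≤ θ t}

section Quantile

lemma invCDF_bddBelow (μ : Measure ℝ) [IsProbabilityMeasure μ] {t : ℝ} (ht : 0 < t) :
    BddBelow {y : ℝ | t ≤ (μ (Iic y)).toReal} := by
  have h := (tendsto_cdf_atBot μ).eventually (gt_mem_nhds ht)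
  obtain ⟨m, hm⟩ := eventually_atBot.1 h
  refine ⟨m, fun y hy => ?_⟩
  by_contra hlt
  have h1 := hm y (not_le.1 hlt).le
  rw [cdf_eq_real] at h1
  exact absurd hy (not_le.2 h1)

lemma invCDF_nonempty (μ : Measure ℝ) [IsProbabilityMeasure μ] {t : ℝ} (ht : t < 1) :
    {y : ℝ | t ≤ (μ (Iic y)).toReal}.Nonempty := by
  have h := (tendsto_cdf_atTop μ).eventually (lt_mem_nhds ht)
  obtain ⟨m, hm⟩ := eventually_atTop.1 h
  refine ⟨m, ?_⟩
  have h1 := hm m le_rfl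
  rw [cdf_eq_real] at h1
  exact h1.le

lemma le_cdf_invCDF (μ : Measure ℝ) [IsProbabilityMeasure μ] {t : ℝ} (ht : t < 1) :
    t ≤ μ.real (Iic (invCDF μ t)) := by
  rw [← cdf_eq_real]
  have hc : Tendsto (cdf μ) (𝓝[>] (invCDF μ t)) (𝓝 (cdf μ (invCDF μ t))) :=
    ((cdf μ).right_continuous _).mono_left (nhdsWithin_mono _ Ioi_subset_Ici_self)
  refine ge_of_tendsto hc ?_
  filter_upwards [self_mem_nhdsWithin] with y hy
  obtain ⟨z, hz, hzy⟩ := exists_lt_of_csInf_lt (invCDF_nonempty μ ht) hy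
  have : cdf μ z ≤ cdf μ y := monotone_cdf μ hzy.le
  rw [cdf_eq_real] at this
  exact le_trans hz this

lemma invCDF_le_iff (μ : Measure ℝ) [IsProbabilityMeasure μ] {t : ℝ} (ht0 : 0 < t) (ht : t < 1)
    (y : ℝ) : invCDF μ t ≤ y ↔ t ≤ μ.real (Iic y) := by
  constructor
  · intro h
    exact (le_cdf_invCDF μ ht).trans (measureReal_mono (Iic_subset_Iic.2 h))
  · intro h
    exact csInf_le (invCDF_bddBelow μ ht0) h

lemma real_Iio_invCDF_le (μ : Measure ℝ) [IsProbabilityMeasure μ] {t : ℝ} (ht0 : 0 < t)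
    (ht : t < 1) : μ.real (Iio (invCDF μ t)) ≤ t := by
  have h : μ (Iio (invCDF μ t)) ≤ ENNReal.ofReal t := by
    obtain ⟨u, hu, hult, hut⟩ := exists_seq_strictMono_tendsto (invCDF μ t)
    have hU : Iio (invCDF μ t) = ⋃ n, Iic (u n) := by
      ext y
      simp only [mem_Iio, mem_iUnion, mem_Iic]
      constructor
      · intro hy
        obtain ⟨n, hn⟩ := (hut.eventually (lt_mem_nhds hy)).exists
        exact ⟨n, hn.le⟩
      · rintro ⟨n, hn⟩
        exact hn.trans_lt (hult n)
    have hm : Monotone fun n => Iic (u n) := fun m n hmn => Iic_subset_Iic.2 (hu.monotone hmn)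
    rw [hU, hm.measure_iUnion]
    refine iSup_le fun n => ?_
    have : ¬ invCDF μ t ≤ u n := not_le.2 (hult n)
    rw [invCDF_le_iff μ ht0 ht, not_le] at this
    rw [← ofReal_measureReal]
    exact ENNReal.ofReal_le_ofReal this.le
  rw [measureReal_def]
  exact ENNReal.toReal_le_of_le_ofReal ht0.le h

lemma invCDF_monoOn (μ : Measure ℝ) [IsProbabilityMeasure μ] :
    MonotoneOn (invCDF μ) (Ioo 0 1) := by
  intro s hs t ht hst
  rw [invCDF_le_iff μ hs.1 hs.2]
  exact hst.trans (le_cdf_invCDF μ ht.2)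

lemma map_invCDF (μ : Measure ℝ) [IsProbabilityMeasure μ] :
    (volume.restrict (Ioo (0:ℝ) 1)).map (invCDF μ) = μ := by
  have hae : AEMeasurable (invCDF μ) (volume.restrict (Ioo (0:ℝ) 1)) :=
    aemeasurable_restrict_of_monotoneOn measurableSet_Ioo (invCDF_monoOn μ)
  have : IsProbabilityMeasure (volume.restrict (Ioo (0:ℝ) 1)) := ⟨by simp⟩
  have : IsProbabilityMeasure ((volume.restrict (Ioo (0:ℝ) 1)).map (invCDF μ)) :=
    Measure.isProbabilityMeasure_map hae
  refine Measure.ext_of_Iic _ _ fun y => ?_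
  rw [Measure.map_apply_of_aemeasurable hae measurableSet_Iic]
  rw [Measure.restrict_apply₀']
  swap
  · exact measurableSet_Ioo.nullMeasurableSet
  have hset : invCDF μ ⁻¹' Iic y ∩ Ioo 0 1 = Ioc 0 (μ.real (Iic y)) ∩ Iio 1 := by
    ext t
    simp only [mem_inter_iff, mem_preimage, mem_Iic, mem_Ioo, mem_Ioc, mem_Iio]
    constructor
    · rintro ⟨h1, h2, h3⟩
      exact ⟨⟨h2, (invCDF_le_iff μ h2 h3 y).1 h1⟩, h3⟩
    · rintro ⟨⟨h1, h2⟩, h3⟩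
      exact ⟨(invCDF_le_iff μ h1 h3 y).2 h2, h1, h3⟩
  rw [hset]
  have hF : μ.real (Iic y) ≤ 1 := measureReal_le_one
  have h1 : volume (Ioc 0 (μ.real (Iic y)) ∩ Iio 1) = volume (Ioc 0 (μ.real (Iic y))) := by
    apply le_antisymm (measure_mono inter_subset_left)
    calc volume (Ioc 0 (μ.real (Iic y))) = volume (Ioo 0 (μ.real (Iic y))) := by simp
      _ ≤ volume (Ioc 0 (μ.real (Iic y)) ∩ Iio 1) :=
        measure_mono fun t ht => ⟨⟨ht.1, ht.2.le⟩, ht.2.trans_le hF⟩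
  rw [h1, Real.volume_Ioc, sub_zero, ofReal_measureReal]

lemma expCDF_pos (x : ℝ) : 0 < expCDF x := by
  unfold expCDF
  split_ifs with h
  · positivity
  · have : Real.exp (-x) ≤ 1 := Real.exp_le_one_iff.2 (by linarith)
    linarith

lemma expCDF_lt_one (x : ℝ) : expCDF x < 1 := by
  unfold expCDF
  split_ifs with h
  · have : Real.exp x ≤ 1 := Real.exp_le_one_iff.2 (by linarith)
    linarith
  · have := Real.exp_pos (-x)
    linarith

lemma expCDF_mono : Monotone expCDF := by
  intro x y hxy
  unfold expCDF
  split_ifs with h h' h'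
  · have := Real.exp_le_exp.2 hxy
    linarith
  · have : Real.exp x ≤ 1 := Real.exp_le_one_iff.2 (by linarith)
    have : Real.exp (-y) ≤ 1 := Real.exp_le_one_iff.2 (by linarith)
    linarith
  · linarith
  · have : Real.exp (-y) ≤ Real.exp (-x) := Real.exp_le_exp.2 (by linarith)
    linarith

lemma Umap_mono (μ : Measure ℝ) [IsProbabilityMeasure μ] : Monotone (Umap μ) := by
  intro x y hxy
  exact invCDF_monoOn μ ⟨expCDF_pos x, expCDF_lt_one x⟩ ⟨expCDF_pos y, expCDF_lt_one y⟩
    (expCDF_mono hxy)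

lemma lintegral_Umap (μ : Measure ℝ) [IsProbabilityMeasure μ] (F : ℝ → ℝ≥0∞) (hF : Measurable F) :
    ∫⁻ y, F y ∂μ = (∫⁻ x in Ioi (0:ℝ), ENNReal.ofReal (Real.exp (-x) / 2) * F (Umap μ x)) +
      ∫⁻ x in Ioi (0:ℝ), ENNReal.ofReal (Real.exp (-x) / 2) * F (Umap μ (-x)) := by
  have hae : AEMeasurable (invCDF μ) (volume.restrict (Ioo (0:ℝ) 1)) :=
    aemeasurable_restrict_of_monotoneOn measurableSet_Ioo (invCDF_monoOn μ)
  conv_lhs => rw [← map_invCDF μ]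
  rw [lintegral_map' hF.aemeasurable hae]
  have hsplit : Ioo (0:ℝ) 1 = Ioo 0 (1/2) ∪ Ico (1/2) 1 := by
    rw [Ioo_union_Ico_eq_Ioo (by norm_num) (by norm_num)]
  rw [hsplit, lintegral_union measurableSet_Ico
    (by rw [Set.disjoint_left]; rintro x ⟨_, h⟩ ⟨h', _⟩; linarith), add_comm]
  have hIco : ∫⁻ x in Ico (1/2:ℝ) 1, F (invCDF μ x) = ∫⁻ x in Ioo (1/2:ℝ) 1, F (invCDF μ x) :=
    setLIntegral_congr Ioo_ae_eq_Ico.symm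
  rw [hIco]
  congr 1
  · have him : Ioo (1/2:ℝ) 1 = Set.image (fun x => 1 - Real.exp (-x) / 2) (Ioi 0) := by
      ext t
      simp only [mem_Ioo, mem_image, mem_Ioi]
      constructor
      · rintro ⟨h1, h2⟩
        refine ⟨-Real.log (2 * (1 - t)), ?_, ?_⟩
        · have := Real.log_neg (x := 2 * (1 - t)) (by linarith) (by linarith)
          linarith
        · rw [neg_neg, Real.exp_log (by linarith)]; ring
      · rintro ⟨x, hx, rfl⟩
        have h1 : Real.exp (-x) < 1 := Real.exp_lt_one_iff.2 (by linarith)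
        have := Real.exp_pos (-x)
        constructor <;> linarith
    rw [him, lintegral_image_eq_lintegral_abs_deriv_mul (f' := fun x => Real.exp (-x) / 2)
      measurableSet_Ioi]
    · refine setLIntegral_congr_fun measurableSet_Ioi fun x hx => ?_
      have hx' : ¬ x < 0 := not_lt.2 (le_of_lt hx)
      simp only [Umap, expCDF, if_neg hx']
      rw [abs_of_pos (by positivity)]
    · intro x hx
      have h := ((((hasDerivAt_id x).neg).exp).div_const 2).const_sub 1
      exact (h.congr_deriv (by simp only [Pi.neg_apply, id_eq]; ring)).hasDerivWithinAt
    · intro x hx y hy hxy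
      simp only at hxy
      have : Real.exp (-x) = Real.exp (-y) := by linarith
      have := Real.exp_injective this
      linarith
  · have him : Ioo (0:ℝ) (1/2) = Set.image (fun x => Real.exp (-x) / 2) (Ioi 0) := by
      ext t
      simp only [mem_Ioo, mem_image, mem_Ioi]
      constructor
      · rintro ⟨h1, h2⟩
        refine ⟨-Real.log (2 * t), ?_, ?_⟩
        · have := Real.log_neg (x := 2 * t) (by linarith) (by linarith)
          linarith
        · rw [neg_neg, Real.exp_log (by linarith)]; ring
      · rintro ⟨x, hx, rfl⟩
        have h1 : Real.exp (-x) < 1 := Real.exp_lt_one_iff.2 (by linarith)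
        have := Real.exp_pos (-x)
        constructor <;> linarith
    rw [him, lintegral_image_eq_lintegral_abs_deriv_mul (f' := fun x => -(Real.exp (-x) / 2))
      measurableSet_Ioi]
    · refine setLIntegral_congr_fun measurableSet_Ioi fun x hx => ?_
      have hx' : -x < 0 := by simpa using hx
      simp only [Umap, expCDF, if_pos hx']
      rw [abs_neg, abs_of_pos (by positivity)]
    · intro x hx
      have h := (((hasDerivAt_id x).neg).exp).div_const 2
      exact (h.congr_deriv (by simp only [Pi.neg_apply, id_eq]; ring)).hasDerivWithinAt
    · intro x hx y hy hxy
      simp only at hxy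
      have : Real.exp (-x) = Real.exp (-y) := by linarith
      have := Real.exp_injective this
      linarith

end Quantile

section HalfLine

/-- `ψ(u) = u e^u - e^u + 1`. -/
noncomputable def psiE (u : ℝ) : ℝ := u * Real.exp u - Real.exp u + 1

/-- `P(u) = u² e^{3u}`. -/
noncomputable def PE (u : ℝ) : ℝ := u ^ 2 * Real.exp (3 * u)

lemma psiE_nonneg (u : ℝ) : 0 ≤ psiE u := by
  unfold psiE
  have h := Real.add_one_le_exp (-u)
  have h2 : Real.exp u * Real.exp (-u) = 1 := by rw [← Real.exp_add]; simp
  nlinarith [Real.exp_pos u]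

lemma exp_sub_one_le (u : ℝ) : Real.exp u - 1 ≤ u * Real.exp u := by
  have := psiE_nonneg u
  unfold psiE at this
  linarith

lemma psiE_le_PE {u : ℝ} (hu : 0 ≤ u) : psiE u ≤ PE u := by
  have h1 := Real.add_one_le_exp u
  have h2 := exp_sub_one_le u
  have h3 : Real.exp u ≤ Real.exp (3 * u) := Real.exp_le_exp.2 (by linarith)
  have h4 : u * (Real.exp u - 1) ≤ u * (u * Real.exp u) := mul_le_mul_of_nonneg_left h2 hu
  have h5 : u ^ 2 * Real.exp u ≤ u ^ 2 * Real.exp (3 * u) :=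
    mul_le_mul_of_nonneg_left h3 (sq_nonneg u)
  unfold psiE PE
  nlinarith

lemma psiE_le_mul_exp {u : ℝ} (hu : 0 ≤ u) : psiE u ≤ u * Real.exp u := by
  have : 1 ≤ Real.exp u := Real.one_le_exp hu
  unfold psiE
  linarith

lemma psiE_le_of_nonpos {u : ℝ} (hu : u ≤ 0) : psiE u ≤ 1 ∧ psiE u ≤ u ^ 2 := by
  have h0 := Real.exp_pos u
  have h1 := Real.add_one_le_exp u
  have h2 : Real.exp u ≤ 1 := Real.exp_le_one_iff.2 hu
  unfold psiE
  constructor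
  · nlinarith
  · nlinarith [mul_nonneg (neg_nonneg.2 hu) (by linarith : 0 ≤ Real.exp u - (u + 1))]

lemma PE_nonneg (u : ℝ) : 0 ≤ PE u := by unfold PE; positivity

lemma PE_mono {u v : ℝ} (hu : 0 ≤ u) (huv : u ≤ v) : PE u ≤ PE v := by
  unfold PE
  gcongr

lemma PE_rec {v d : ℝ} (hv : 0 ≤ v) (hd : 0 ≤ d) (hd' : d ≤ 1 / 100) :
    PE (v + d) ≤ Real.exp (1 / 2) * PE v + 11 * Real.exp 4 * d ^ 2 := by
  unfold PE
  have hexp : Real.exp (3 * (v + d)) = Real.exp (3 * v) * Real.exp (3 * d) := by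
    rw [← Real.exp_add]; ring_nf
  have h3 : Real.exp (3 * d) ≤ Real.exp (3 / 100) := Real.exp_le_exp.2 (by linarith)
  rcases le_or_gt 1 v with h | h
  · have h5 : (v + d) ^ 2 ≤ (Real.exp (1 / 100)) ^ 2 * v ^ 2 := by
      rw [← mul_pow]
      have := Real.add_one_le_exp (1 / 100 : ℝ)
      gcongr
      nlinarith
    have h6 : Real.exp (1/100) ^ 2 * Real.exp (3/100) ≤ Real.exp (1/2) := by
      rw [← Real.exp_nat_mul, ← Real.exp_add]
      exact Real.exp_le_exp.2 (by norm_num)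
    calc (v + d) ^ 2 * Real.exp (3 * (v + d))
        ≤ (Real.exp (1 / 100) ^ 2 * v ^ 2) * (Real.exp (3 * v) * Real.exp (3 / 100)) := by
          rw [hexp]; gcongr
      _ = (Real.exp (1 / 100) ^ 2 * Real.exp (3 / 100)) * (v ^ 2 * Real.exp (3 * v)) := by ring
      _ ≤ Real.exp (1/2) * (v ^ 2 * Real.exp (3 * v)) := by gcongr
      _ ≤ _ := by
        have : 0 ≤ 11 * Real.exp 4 * d ^ 2 := by positivity
        linarith
  · have h5 : (v + d) ^ 2 ≤ Real.exp (1/10) * v ^ 2 + 11 * d ^ 2 := by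
      have := Real.add_one_le_exp (1 / 10 : ℝ)
      nlinarith [sq_nonneg (v - 10 * d), sq_nonneg v]
    have h6 : Real.exp (1/10) * Real.exp (3/100) ≤ Real.exp (1/2) := by
      rw [← Real.exp_add]
      exact Real.exp_le_exp.2 (by norm_num)
    have h7 : Real.exp (3 * v) * Real.exp (3 / 100) ≤ Real.exp 4 := by
      rw [← Real.exp_add]
      exact Real.exp_le_exp.2 (by linarith)
    calc (v + d) ^ 2 * Real.exp (3 * (v + d))
        ≤ (Real.exp (1/10) * v ^ 2 + 11 * d ^ 2) * (Real.exp (3 * v) * Real.exp (3 / 100)) := by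
          rw [hexp]; gcongr
      _ = (Real.exp (1/10) * Real.exp (3/100)) * (v ^ 2 * Real.exp (3 * v))
          + 11 * d ^ 2 * (Real.exp (3 * v) * Real.exp (3 / 100)) := by ring
      _ ≤ Real.exp (1/2) * (v ^ 2 * Real.exp (3 * v)) + 11 * d ^ 2 * Real.exp 4 := by gcongr
      _ = _ := by ring

lemma absorb {s k : ℝ≥0∞} (hs : s ≠ ⊤) (h : s ≤ ENNReal.ofReal (2 / 3) * s + k) : s ≤ 3 * k := by
  by_cases hk : k = ⊤
  · simp [hk]
  lift s to ℝ≥0 using hs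
  lift k to ℝ≥0 using hk
  have h2 : ENNReal.ofReal (2/3) = ((2/3 : ℝ≥0) : ℝ≥0∞) := by
    rw [ENNReal.ofReal, Real.toNNReal_div (by norm_num)]; norm_num
  rw [h2] at h
  norm_cast at h ⊢
  have h' : (s : ℝ) ≤ 2 / 3 * s + k := by exact_mod_cast h
  have : (s : ℝ) ≤ 3 * k := by linarith
  exact_mod_cast this

lemma lintegral_exp_Ioi (y : ℝ) {k : ℝ} (hk : 0 < k) :
    ∫⁻ x in Ioi y, ENNReal.ofReal (Real.exp (-(k * x))) = ENNReal.ofReal (Real.exp (-(k * y)) / k) := by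
  have hi : IntegrableOn (fun x => Real.exp ((-k) * x)) (Ioi y) :=
    integrableOn_exp_mul_Ioi (by linarith) y
  have h := integral_exp_mul_Ioi (a := -k) (by linarith) y
  have h2 := ofReal_integral_eq_lintegral_ofReal hi (Eventually.of_forall fun x => (Real.exp_pos _).le)
  simp only [neg_mul] at h h2
  rw [← h2, h]
  congr 1
  field_simp

/-- The constant of the recursion. -/
noncomputable def CE : ℝ := 11 * Real.exp 4

lemma CE_ge : 1 ≤ CE := by
  have := Real.one_le_exp (show (0:ℝ) ≤ 4 by norm_num)
  unfold CE; linarith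

lemma half_small (u d R : ℝ → ℝ) (hu : Measurable u) (hd : Measurable d) (hR : Measurable R)
    (hu0 : ∀ x > 0, 0 ≤ u x) (hd0 : ∀ x > 0, 0 ≤ d x)
    (hum : MonotoneOn u (Ioi 0)) (hdm : MonotoneOn d (Ioi 0))
    (h1 : ∀ x > 0, x ≤ 1 → u x ≤ d x) (h2 : ∀ x > 1, u x ≤ u (x - 1) + d x)
    (hE : ∀ x > 0, d x ≤ 1 / 100 → d x ^ 2 ≤ R x) :
    ∫⁻ x in {x | 0 < x ∧ d x ≤ 1 / 100}, ENNReal.ofReal (PE (u x) * Real.exp (-x)) ≤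
      3 * (ENNReal.ofReal CE *
        ∫⁻ x in Ioi 0, ENNReal.ofReal (R x * Real.exp (u x) * Real.exp (-x))) := by
  set J := ∫⁻ x in Ioi (0:ℝ), ENNReal.ofReal (R x * Real.exp (u x) * Real.exp (-x)) with hJ
  set E : Set ℝ := {x | 0 < x ∧ d x ≤ 1 / 100} with hEdef
  set Pf : ℝ → ℝ≥0∞ := fun x => ENNReal.ofReal (PE (u x) * Real.exp (-x)) with hPf
  have hPm : Measurable Pf := by
    unfold Pf PE; fun_prop
  have hEm : MeasurableSet E :=
    (measurableSet_lt measurable_const measurable_id).inter (measurableSet_le hd measurable_const)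
  have hn : ∀ n : ℕ, ∫⁻ x in E ∩ Iic (n:ℝ), Pf x ≤ 3 * (ENNReal.ofReal CE * J) := by
    intro n
    have hEn : MeasurableSet (E ∩ Iic (n:ℝ)) := hEm.inter measurableSet_Iic
    apply absorb
    · have hb : ∫⁻ x in E ∩ Iic (n:ℝ), Pf x ≤
          ∫⁻ x in Ioc 0 (n:ℝ), ENNReal.ofReal (PE (u n)) := by
        refine le_trans (lintegral_mono_set (t := Ioc 0 (n:ℝ)) fun x hx => ⟨hx.1.1, hx.2⟩) ?_
        refine setLIntegral_mono' measurableSet_Ioc fun x hx => ?_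
        apply ENNReal.ofReal_le_ofReal
        have ha : PE (u x) ≤ PE (u n) :=
          PE_mono (hu0 x hx.1) (hum hx.1 (mem_Ioi.2 (hx.1.trans_le hx.2)) hx.2)
        have hb : Real.exp (-x) ≤ 1 := Real.exp_le_one_iff.2 (by linarith [hx.1])
        nlinarith [PE_nonneg (u x), Real.exp_pos (-x)]
      refine ne_top_of_le_ne_top ?_ hb
      rw [setLIntegral_const]
      exact ENNReal.mul_ne_top ENNReal.ofReal_ne_top (by simp)
    · have hpt : ∀ x ∈ E ∩ Iic (n:ℝ), Pf x ≤
          ENNReal.ofReal (2/3) * ((E ∩ Iic (n:ℝ)).indicator Pf) (x - 1) +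
          ENNReal.ofReal CE * ENNReal.ofReal (R x * Real.exp (u x) * Real.exp (-x)) := by
        intro x hx
        have hx0 : 0 < x := hx.1.1
        have hdx := hx.1.2
        have hRx := hE x hx0 hdx
        have hR' : d x ^ 2 ≤ R x * Real.exp (u x) := by
          have := Real.one_le_exp (hu0 x hx0)
          nlinarith [sq_nonneg (d x)]
        have hC0 : 0 ≤ CE := by linarith [CE_ge]
        have hR'' : CE * (d x ^ 2 * Real.exp (-x)) ≤
            CE * (R x * Real.exp (u x) * Real.exp (-x)) := by gcongr
        rcases le_or_gt x 1 with hx1 | hx1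
        · refine le_trans ?_ le_add_self
          rw [← ENNReal.ofReal_mul hC0]
          apply ENNReal.ofReal_le_ofReal
          refine le_trans ?_ hR''
          have ha : PE (u x) ≤ PE (0 + d x) := PE_mono (hu0 x hx0) (by linarith [h1 x hx0 hx1])
          have hb := PE_rec le_rfl (hd0 x hx0) hdx
          have hc : PE 0 = 0 := by simp [PE]
          rw [hc] at hb
          have : PE (u x) ≤ CE * d x ^ 2 := by unfold CE; linarith
          calc PE (u x) * Real.exp (-x) ≤ (CE * d x ^ 2) * Real.exp (-x) := by gcongr
            _ = _ := by ring
        · have hmem : x - 1 ∈ E ∩ Iic (n:ℝ) := by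
            refine ⟨⟨by linarith, ?_⟩, ?_⟩
            · exact (hdm (mem_Ioi.2 (by linarith)) hx0 (by linarith)).trans hdx
            · have := hx.2
              simp only [mem_Iic] at this ⊢
              linarith
          rw [indicator_of_mem hmem, hPf]
          simp only
          rw [← ENNReal.ofReal_mul hC0, ← ENNReal.ofReal_mul (by norm_num),
            ← ENNReal.ofReal_add (mul_nonneg (by norm_num) (mul_nonneg (PE_nonneg _) (Real.exp_pos _).le))
            (le_trans (by positivity) hR'')]
          apply ENNReal.ofReal_le_ofReal
          have hv : 0 ≤ u (x - 1) := hu0 _ (by linarith)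
          have ha : PE (u x) ≤ PE (u (x-1) + d x) := PE_mono (hu0 x hx0) (h2 x hx1)
          have hb := PE_rec hv (hd0 x hx0) hdx
          have he : Real.exp (1/2) * Real.exp (-x) ≤ 2/3 * Real.exp (-(x-1)) := by
            have e1 : Real.exp (-(x-1)) = Real.exp (1/2) * Real.exp (1/2) * Real.exp (-x) := by
              rw [← Real.exp_add, ← Real.exp_add]; ring_nf
            rw [e1]
            have := Real.add_one_le_exp (1/2:ℝ)
            have hp : 0 < Real.exp (1/2) * Real.exp (-x) := by positivity
            nlinarith
          have hP := PE_nonneg (u (x-1))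
          calc PE (u x) * Real.exp (-x)
              ≤ (Real.exp (1/2) * PE (u (x-1)) + CE * d x ^ 2) * Real.exp (-x) := by
                gcongr; unfold CE; linarith
            _ = PE (u (x-1)) * (Real.exp (1/2) * Real.exp (-x)) + CE * (d x ^ 2 * Real.exp (-x)) := by
                ring
            _ ≤ PE (u (x-1)) * (2/3 * Real.exp (-(x-1))) +
                CE * (R x * Real.exp (u x) * Real.exp (-x)) := by gcongr
            _ = _ := by ring
      calc ∫⁻ x in E ∩ Iic (n:ℝ), Pf x ≤ ∫⁻ x in E ∩ Iic (n:ℝ),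
            (ENNReal.ofReal (2/3) * ((E ∩ Iic (n:ℝ)).indicator Pf) (x - 1) +
            ENNReal.ofReal CE * ENNReal.ofReal (R x * Real.exp (u x) * Real.exp (-x))) :=
            setLIntegral_mono' hEn hpt
        _ = ENNReal.ofReal (2/3) * (∫⁻ x in E ∩ Iic (n:ℝ), ((E ∩ Iic (n:ℝ)).indicator Pf) (x - 1)) +
            ENNReal.ofReal CE * ∫⁻ x in E ∩ Iic (n:ℝ),
              ENNReal.ofReal (R x * Real.exp (u x) * Real.exp (-x)) := by
            rw [lintegral_add_right _ (by fun_prop), lintegral_const_mul' _ _ ENNReal.ofReal_ne_top,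
              lintegral_const_mul' _ _ ENNReal.ofReal_ne_top]
        _ ≤ _ := by
            refine add_le_add (mul_le_mul' le_rfl ?_)
              (mul_le_mul' le_rfl (lintegral_mono_set fun x hx => hx.1.1))
            refine (setLIntegral_le_lintegral _ _).trans ?_
            rw [lintegral_sub_right_eq_self (fun x => (E ∩ Iic (n:ℝ)).indicator Pf x) 1,
              lintegral_indicator hEn]
  have hU : E = ⋃ n : ℕ, E ∩ Iic (n:ℝ) := by
    rw [← inter_iUnion, eq_comm, inter_eq_left]
    intro x _
    obtain ⟨n, hn⟩ := exists_nat_ge x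
    exact mem_iUnion.2 ⟨n, hn⟩
  rw [hU, setLIntegral_iUnion_of_directed]
  · exact iSup_le hn
  · apply Monotone.directed_le
    intro m n hmn
    exact inter_subset_inter_right _ (Iic_subset_Iic.2 (by exact_mod_cast hmn))

/-- The constant in the half-line estimate. -/
noncomputable def CH : ℝ := 3 * CE + (4 + 30 * (Real.exp 3 + 9 * CE))

lemma big_pt {u R T s : ℝ} (hu : 0 ≤ u) (hR : 0 ≤ R) (hs : 0 ≤ s) (hT0 : 0 ≤ T)
    (h : u ≤ T + (R + s) / 2) :
    psiE u ≤ 4 * (R * Real.exp u) + 10 * Real.exp (2 * T) * Real.exp (2 / 3 * s) := by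
  have h0 := psiE_le_mul_exp hu
  have hp := Real.exp_pos u
  rcases le_or_gt u (4 * R) with hc | hc
  · have : u * Real.exp u ≤ 4 * R * Real.exp u := by gcongr
    have : 0 ≤ 10 * Real.exp (2 * T) * Real.exp (2 / 3 * s) := by positivity
    linarith
  · have hT : u ≤ 8 / 7 * T + 4 / 7 * s := by linarith
    have h1 : u ≤ 10 * Real.exp (u / 10) := by linarith [Real.add_one_le_exp (u / 10)]
    have h2 : u * Real.exp u ≤ 10 * Real.exp (2 * T + 2 / 3 * s) := by
      calc u * Real.exp u ≤ 10 * Real.exp (u / 10) * Real.exp u := by gcongr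
        _ = 10 * Real.exp (u / 10 + u) := by rw [Real.exp_add]; ring
        _ ≤ _ := by
          have := Real.exp_le_exp.2 (by linarith : u / 10 + u ≤ 2 * T + 2 / 3 * s)
          linarith
    rw [Real.exp_add] at h2
    have : 0 ≤ 4 * (R * Real.exp u) := by positivity
    linarith

lemma half_line (u d R : ℝ → ℝ) (hu : Measurable u) (hd : Measurable d) (hR : Measurable R)
    (hu0 : ∀ x > 0, 0 ≤ u x) (hd0 : ∀ x > 0, 0 ≤ d x) (hR0 : ∀ x > 0, 0 ≤ R x)
    (hum : MonotoneOn u (Ioi 0)) (hdm : MonotoneOn d (Ioi 0))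
    (h1 : ∀ x > 0, x ≤ 1 → u x ≤ d x) (h2 : ∀ x > 1, u x ≤ u (x - 1) + d x)
    (hE : ∀ x > 0, d x ≤ 1 / 100 → d x ^ 2 ≤ R x)
    (hB : ∀ x > 0, 1 / 100 < d x → 1 ≤ R x)
    (h3 : ∀ x y, 0 < y → y < x → 1 / 100 < d x → u x ≤ u y + (R x + (x - y)) / 2)
    (h3' : ∀ x > 0, 1 / 100 < d x → u x ≤ (R x + x) / 2) :
    ∫⁻ x in Ioi 0, ENNReal.ofReal (psiE (u x) * Real.exp (-x)) ≤
      ENNReal.ofReal CH *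
        ∫⁻ x in Ioi 0, ENNReal.ofReal (R x * Real.exp (u x) * Real.exp (-x)) := by
  have hS := half_small u d R hu hd hR hu0 hd0 hum hdm h1 h2 hE
  set J := ∫⁻ x in Ioi (0:ℝ), ENNReal.ofReal (R x * Real.exp (u x) * Real.exp (-x)) with hJ
  set E : Set ℝ := {x | 0 < x ∧ d x ≤ 1 / 100} with hEdef
  set B : Set ℝ := {x | 0 < x ∧ 1 / 100 < d x} with hBdef
  have hCE := CE_ge
  have hC0 : 0 ≤ CE := by linarith
  have hEm : MeasurableSet E :=
    (measurableSet_lt measurable_const measurable_id).inter (measurableSet_le hd measurable_const)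
  have hBm : MeasurableSet B :=
    (measurableSet_lt measurable_const measurable_id).inter (measurableSet_lt measurable_const hd)
  have hunion : Ioi (0:ℝ) = E ∪ B := by
    ext x
    simp only [mem_Ioi, mem_union, hEdef, hBdef, mem_ofPred_eq]
    constructor
    · intro hx
      rcases le_or_gt (d x) (1/100) with h | h
      · exact Or.inl ⟨hx, h⟩
      · exact Or.inr ⟨hx, h⟩
    · rintro (h | h) <;> exact h.1
  have hS1 : ∫⁻ x in E, ENNReal.ofReal (psiE (u x) * Real.exp (-x)) ≤
      ENNReal.ofReal (3 * CE) * J := by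
    rw [ENNReal.ofReal_mul (by norm_num), mul_assoc]
    have : ENNReal.ofReal 3 = 3 := by norm_num
    rw [this]
    refine le_trans (setLIntegral_mono' hEm fun x hx => ?_) hS
    apply ENNReal.ofReal_le_ofReal
    have := psiE_le_PE (hu0 x hx.1)
    gcongr
  -- the pivot point
  have hpivot : B.Nonempty → ∃ y T : ℝ, 0 ≤ T ∧ 0 ≤ y ∧ Ioi (y + 1) ⊆ B ∧ B ⊆ Ioi y ∧
      (∀ x ∈ B, u x ≤ T + (R x + (x - y)) / 2) ∧
      ENNReal.ofReal (PE T * Real.exp (-y)) ≤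
        ENNReal.ofReal (6 * CE) * J + ENNReal.ofReal (CE * Real.exp (-y)) := by
    rintro ⟨z, hz⟩
    have hup : ∀ x ∈ B, ∀ x', x ≤ x' → x' ∈ B := fun x hx x' hxx' =>
      ⟨hx.1.trans_le hxx', hx.2.trans_le (hdm hx.1 (mem_Ioi.2 (hx.1.trans_le hxx')) hxx')⟩
    rcases E.eq_empty_or_nonempty with hEe | ⟨e, he⟩
    · have hBI : B = Ioi 0 := by rw [hunion, hEe, empty_union]
      refine ⟨0, 0, le_rfl, le_rfl, ?_, ?_, ?_, ?_⟩
      · rw [hBI]; intro x hx; simp only [mem_Ioi] at hx ⊢; linarith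
      · rw [hBI]
      · intro x hx
        have := h3' x hx.1 hx.2
        linarith
      · simp [PE]
    · have hex : ∃ n : ℕ, e + n ∈ B := by
        obtain ⟨n, hn⟩ := exists_nat_ge (z - e)
        exact ⟨n, hup z hz _ (by linarith)⟩
      classical
      set n := Nat.find hex with hndef
      have hn : e + (n:ℝ) ∈ B := Nat.find_spec hex
      have hn0 : n ≠ 0 := by
        intro h0
        rw [h0] at hn
        simp only [Nat.cast_zero, add_zero] at hn
        exact absurd hn.2 (not_lt.2 he.2)
      obtain ⟨m, hm⟩ := Nat.exists_eq_succ_of_ne_zero hn0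
      have hmB : e + (m:ℝ) ∉ B := Nat.find_min hex (by omega)
      have hm0 : 0 < e + (m:ℝ) := by have := he.1; positivity
      have hmE : e + (m:ℝ) ∈ E := by
        have : e + (m:ℝ) ∈ E ∪ B := by rw [← hunion]; exact hm0
        exact this.resolve_right hmB
      set y := e + (m:ℝ) with hy
      have hBy : B ⊆ Ioi y := by
        intro x hx
        by_contra hxy
        exact hmB (hup x hx _ (not_lt.1 hxy))
      refine ⟨y, u y, hu0 y hm0, hm0.le, ?_, hBy, ?_, ?_⟩
      · intro x hx
        refine hup _ hn x ?_
        rw [hm]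
        push_cast
        have := mem_Ioi.1 hx
        linarith
      · intro x hx
        exact h3 x y hm0 (hBy hx) hx.2
      · have hdy : d y ^ 2 ≤ 1 := by nlinarith [hd0 y hm0, hmE.2]
        rcases le_or_gt y 1 with hy1 | hy1
        · refine le_trans ?_ le_add_self
          apply ENNReal.ofReal_le_ofReal
          have ha : PE (u y) ≤ PE (0 + d y) := PE_mono (hu0 y hm0) (by linarith [h1 y hm0 hy1])
          have hb := PE_rec le_rfl (hd0 y hm0) hmE.2
          have hc : PE 0 = 0 := by simp [PE]
          rw [hc] at hb
          have : PE (u y) ≤ CE := by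
            have : CE * d y ^ 2 ≤ CE * 1 := by gcongr
            unfold CE at this ⊢; linarith
          gcongr
        · have hv : 0 ≤ u (y - 1) := hu0 _ (by linarith)
          have ha : PE (u y) ≤ PE (u (y-1) + d y) := PE_mono (hu0 y hm0) (h2 y hy1)
          have hb := PE_rec hv (hd0 y hm0) hmE.2
          have he2 : Real.exp (1/2) ≤ 2 := by
            have h4 : Real.exp (1/2) ^ 2 ≤ 2 ^ 2 := by
              rw [← Real.exp_nat_mul]
              have : ((2:ℕ):ℝ) * (1/2) = 1 := by norm_num
              rw [this]
              linarith [Real.exp_one_lt_d9]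
            exact le_of_sq_le_sq h4 (by norm_num)
          have hPy : PE (u y) ≤ 2 * PE (u (y-1)) + CE := by
            have : CE * d y ^ 2 ≤ CE * 1 := by gcongr
            have : Real.exp (1/2) * PE (u (y-1)) ≤ 2 * PE (u (y-1)) :=
              mul_le_mul_of_nonneg_right he2 (PE_nonneg _)
            unfold CE at *; linarith
          have hInte : ENNReal.ofReal (PE (u (y-1)) * Real.exp (-y)) ≤ 3 * (ENNReal.ofReal CE * J) := by
            refine le_trans ?_ hS
            have : ENNReal.ofReal (PE (u (y-1)) * Real.exp (-y)) =
                ∫⁻ x in Ioc (y-1) y, ENNReal.ofReal (PE (u (y-1)) * Real.exp (-y)) := by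
              rw [setLIntegral_const]; simp
            rw [this]
            refine le_trans (setLIntegral_mono' measurableSet_Ioc fun x hx => ?_)
              (lintegral_mono_set (s := Ioc (y-1) y) fun x hx => ?_)
            · apply ENNReal.ofReal_le_ofReal
              have ha : PE (u (y-1)) ≤ PE (u x) :=
                PE_mono hv (hum (mem_Ioi.2 (by linarith)) (mem_Ioi.2 (by linarith [hx.1])) hx.1.le)
              have hb : Real.exp (-y) ≤ Real.exp (-x) := Real.exp_le_exp.2 (by linarith [hx.2])
              have := PE_nonneg (u x)
              gcongr
            · have hx0 : 0 < x := by linarith [hx.1]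
              exact ⟨hx0, (hdm hx0 hm0 hx.2).trans hmE.2⟩
          calc ENNReal.ofReal (PE (u y) * Real.exp (-y))
              ≤ ENNReal.ofReal (2 * (PE (u (y-1)) * Real.exp (-y)) + CE * Real.exp (-y)) := by
                apply ENNReal.ofReal_le_ofReal
                have := mul_le_mul_of_nonneg_right hPy (Real.exp_pos (-y)).le
                linarith
            _ = 2 * ENNReal.ofReal (PE (u (y-1)) * Real.exp (-y)) +
                ENNReal.ofReal (CE * Real.exp (-y)) := by
                rw [ENNReal.ofReal_add (by have := PE_nonneg (u (y-1)); positivity) (by positivity),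
                  ENNReal.ofReal_mul (by norm_num)]
                norm_num
            _ ≤ 2 * (3 * (ENNReal.ofReal CE * J)) + ENNReal.ofReal (CE * Real.exp (-y)) := by
                gcongr
            _ = _ := by
                rw [ENNReal.ofReal_mul (by norm_num : (0:ℝ) ≤ 6)]
                have : ENNReal.ofReal 6 = 2 * 3 := by norm_num
                rw [this]; ring
  have hBJ : ∫⁻ x in B, ENNReal.ofReal (psiE (u x) * Real.exp (-x)) ≤
      ENNReal.ofReal (4 + 30 * (Real.exp 3 + 9 * CE)) * J := by
    rcases B.eq_empty_or_nonempty with hBe | hBn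
    · rw [hBe]; simp
    obtain ⟨y, T, hT0, hy0, hyB, hBy, hbd, hPT⟩ := hpivot hBn
    have hyJ : ENNReal.ofReal (Real.exp (-y)) ≤ ENNReal.ofReal (Real.exp 1) * J := by
      have h1 := lintegral_exp_Ioi (y + 1) (k := 1) one_pos
      simp only [one_mul, div_one] at h1
      have h2 : ENNReal.ofReal (Real.exp (-y)) = ENNReal.ofReal (Real.exp 1) *
          ENNReal.ofReal (Real.exp (-(y+1))) := by
        rw [← ENNReal.ofReal_mul (Real.exp_pos _).le, ← Real.exp_add]; ring_nf
      rw [h2, ← h1]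
      refine mul_le_mul' le_rfl ?_
      refine le_trans (setLIntegral_mono' measurableSet_Ioi fun x hx => ?_)
        (lintegral_mono_set (s := Ioi (y+1)) fun x hx => (hyB hx).1)
      apply ENNReal.ofReal_le_ofReal
      have hx' := hyB hx
      have ha := hB x hx'.1 hx'.2
      have hb := Real.one_le_exp (hu0 x hx'.1)
      have hc : 1 ≤ R x * Real.exp (u x) := by nlinarith
      have := Real.exp_pos (-x)
      nlinarith
    have hT : Real.exp (2 * T) ≤ Real.exp 2 + PE T := by
      rcases le_or_gt T 1 with hT | hT
      · have := PE_nonneg T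
        have : Real.exp (2 * T) ≤ Real.exp 2 := Real.exp_le_exp.2 (by linarith)
        linarith
      · have h1 : Real.exp (2 * T) ≤ Real.exp (3 * T) := Real.exp_le_exp.2 (by linarith)
        have h2 : 1 * Real.exp (3 * T) ≤ T ^ 2 * Real.exp (3 * T) := by gcongr; nlinarith
        have := Real.exp_pos 2
        unfold PE
        linarith
    have hInte : ∫⁻ x in Ioi y, ENNReal.ofReal (10 * Real.exp (2 * T) * Real.exp (2/3 * (x - y)) *
        Real.exp (-x)) = ENNReal.ofReal (30 * Real.exp (2 * T) * Real.exp (-y)) := by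
      have h1 := lintegral_exp_Ioi y (k := 1/3) (by norm_num)
      have h2 : ∀ x, ENNReal.ofReal (10 * Real.exp (2 * T) * Real.exp (2/3 * (x - y)) *
        Real.exp (-x)) = ENNReal.ofReal (10 * Real.exp (2 * T) * Real.exp (-(2/3) * y)) *
          ENNReal.ofReal (Real.exp (-(1/3 * x))) := by
        intro x
        rw [← ENNReal.ofReal_mul (by positivity)]
        congr 1
        rw [mul_assoc, mul_assoc (10 * Real.exp (2*T)), ← Real.exp_add, ← Real.exp_add]
        ring_nf
      simp_rw [h2]
      rw [lintegral_const_mul' _ _ ENNReal.ofReal_ne_top, h1, ← ENNReal.ofReal_mul (by positivity)]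
      congr 1
      have : Real.exp (-y) = Real.exp (-(2/3) * y) * Real.exp (-(1/3 * y)) := by
        rw [← Real.exp_add]; ring_nf
      rw [this]; ring
    calc ∫⁻ x in B, ENNReal.ofReal (psiE (u x) * Real.exp (-x))
        ≤ ∫⁻ x in B, (ENNReal.ofReal 4 * ENNReal.ofReal (R x * Real.exp (u x) * Real.exp (-x)) +
          ENNReal.ofReal (10 * Real.exp (2 * T) * Real.exp (2/3 * (x - y)) * Real.exp (-x))) := by
          refine setLIntegral_mono' hBm fun x hx => ?_
          have hRx := hR0 x hx.1
          rw [← ENNReal.ofReal_mul (by norm_num), ← ENNReal.ofReal_add (by positivity) (by positivity)]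
          apply ENNReal.ofReal_le_ofReal
          have h := big_pt (hu0 x hx.1) hRx (by linarith [mem_Ioi.1 (hBy hx)] : 0 ≤ x - y) hT0 (hbd x hx)
          have := mul_le_mul_of_nonneg_right h (Real.exp_pos (-x)).le
          linarith
      _ = ENNReal.ofReal 4 * (∫⁻ x in B, ENNReal.ofReal (R x * Real.exp (u x) * Real.exp (-x))) +
          ∫⁻ x in B, ENNReal.ofReal (10 * Real.exp (2 * T) * Real.exp (2/3 * (x - y)) *
            Real.exp (-x)) := by
          rw [lintegral_add_right _ (by fun_prop), lintegral_const_mul' _ _ ENNReal.ofReal_ne_top]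
      _ ≤ ENNReal.ofReal 4 * J + ENNReal.ofReal (30 * Real.exp (2 * T) * Real.exp (-y)) := by
          rw [← hInte]
          exact add_le_add (mul_le_mul' le_rfl (lintegral_mono_set fun x hx => hx.1))
            (lintegral_mono_set hBy)
      _ ≤ ENNReal.ofReal 4 * J + ENNReal.ofReal 30 * (ENNReal.ofReal (Real.exp 2 * Real.exp (-y)) +
            ENNReal.ofReal (PE T * Real.exp (-y))) := by
          have hP := PE_nonneg T
          rw [← ENNReal.ofReal_add (by positivity) (by positivity),
            ← ENNReal.ofReal_mul (by norm_num : (0:ℝ) ≤ 30)]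
          refine add_le_add le_rfl (ENNReal.ofReal_le_ofReal ?_)
          have := mul_le_mul_of_nonneg_right hT (Real.exp_pos (-y)).le
          linarith
      _ ≤ ENNReal.ofReal 4 * J + ENNReal.ofReal 30 * (ENNReal.ofReal (Real.exp 3) * J +
            (ENNReal.ofReal (6 * CE) * J + ENNReal.ofReal (3 * CE) * J)) := by
          refine add_le_add le_rfl (mul_le_mul' le_rfl (add_le_add ?_ (hPT.trans (add_le_add le_rfl ?_))))
          · rw [ENNReal.ofReal_mul (Real.exp_pos _).le]
            refine (mul_le_mul' le_rfl hyJ).trans ?_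
            rw [← mul_assoc, ← ENNReal.ofReal_mul (Real.exp_pos _).le, ← Real.exp_add]
            norm_num
          · rw [ENNReal.ofReal_mul hC0]
            refine (mul_le_mul' le_rfl hyJ).trans ?_
            rw [← mul_assoc, ← ENNReal.ofReal_mul hC0]
            refine mul_le_mul' (ENNReal.ofReal_le_ofReal ?_) le_rfl
            nlinarith [Real.exp_one_lt_d9]
      _ = _ := by
          have e0 := (Real.exp_pos 3).le
          rw [← add_mul, ← add_mul, ← mul_assoc, ← add_mul, ← ENNReal.ofReal_add (by positivity) (by positivity),
            ← ENNReal.ofReal_add (by positivity) (by positivity), ← ENNReal.ofReal_mul (by positivity),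
            ← ENNReal.ofReal_add (by positivity) (by positivity)]
          congr 2
          ring
  calc ∫⁻ x in Ioi 0, ENNReal.ofReal (psiE (u x) * Real.exp (-x))
      = ∫⁻ x in E ∪ B, ENNReal.ofReal (psiE (u x) * Real.exp (-x)) := by rw [← hunion]
    _ ≤ _ := lintegral_union_le _ _ _
    _ ≤ ENNReal.ofReal (3 * CE) * J + ENNReal.ofReal (4 + 30 * (Real.exp 3 + 9 * CE)) * J :=
        add_le_add hS1 hBJ
    _ = _ := by
        rw [← add_mul, ← ENNReal.ofReal_add (by positivity) (by positivity)]
        rfl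

end HalfLine

section HFacts

/-- The standing assumptions on the cost `H` and its conjugate. -/
structure HData (H Hstar : ℝ → ℝ) (t₀ A α : ℝ) : Prop where
  ht₀ : 0 < t₀
  nn : ∀ x, 0 ≤ H x
  symm : ∀ x, H (-x) = H x
  conv : ConvexOn ℝ Set.univ H
  quad : ∀ x : ℝ, |x| ≤ 2 * t₀ → H x = x ^ 2 / 4
  star : ∀ x, IsLUB (Set.range fun y => x * y - H y) (Hstar x)
  super : Tendsto (fun x => Hstar x / x) atTop atTop
  hA : 1 ≤ A
  hα₁ : 1 < α
  hα₂ : α ≤ 2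
  scale : ∀ x : ℝ, ∀ s ∈ Set.Icc (0:ℝ) 1, H (s * x) ≤ A * s ^ α * H x

variable {H Hstar : ℝ → ℝ} {t₀ A α : ℝ}

namespace HData

lemma zero (D : HData H Hstar t₀ A α) : H 0 = 0 := by
  have := D.quad 0 (by simpa using D.ht₀.le)
  simpa using this

lemma cont (D : HData H Hstar t₀ A α) : Continuous H := by
  rw [← continuousOn_univ]
  exact D.conv.continuousOn isOpen_univ

lemma abs_eq (D : HData H Hstar t₀ A α) (x : ℝ) : H |x| = H x := by
  rcases abs_choice x with h | h <;> rw [h]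
  exact D.symm x

lemma sub_scale (D : HData H Hstar t₀ A α) {s : ℝ} (hs : 0 ≤ s) (hs1 : s ≤ 1) (x : ℝ) :
    H (s * x) ≤ s * H x := by
  have := D.conv.2 (mem_univ x) (mem_univ 0) hs (sub_nonneg.2 hs1) (by ring)
  simpa [D.zero] using this

lemma mono (D : HData H Hstar t₀ A α) {x y : ℝ} (hx : 0 ≤ x) (hxy : x ≤ y) : H x ≤ H y := by
  rcases hx.eq_or_lt with rfl | hx0
  · rw [D.zero]; exact D.nn y
  have hy : 0 < y := hx0.trans_le hxy
  have h := D.sub_scale (div_nonneg hx hy.le) ((div_le_one hy).2 hxy) y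
  rw [div_mul_cancel₀ _ hy.ne'] at h
  have h2 : x / y * H y ≤ 1 * H y := mul_le_mul_of_nonneg_right ((div_le_one hy).2 hxy) (D.nn y)
  linarith

lemma mono_abs (D : HData H Hstar t₀ A α) {x y : ℝ} (hxy : |x| ≤ |y|) : H x ≤ H y := by
  rw [← D.abs_eq x, ← D.abs_eq y]
  exact D.mono (abs_nonneg _) hxy

lemma mul_le (D : HData H Hstar t₀ A α) {C : ℝ} (hC : 1 ≤ C) (y : ℝ) : C * H y ≤ H (C * y) := by
  have hC0 : 0 < C := by linarith
  have h := D.sub_scale (inv_nonneg.2 hC0.le) (inv_le_one_of_one_le₀ hC) (C * y)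
  rw [inv_mul_cancel_left₀ hC0.ne'] at h
  calc C * H y ≤ C * (C⁻¹ * H (C * y)) := by gcongr
    _ = H (C * y) := by field_simp

lemma young (D : HData H Hstar t₀ A α) (x y : ℝ) : x * y ≤ H y + Hstar x := by
  have := (D.star x).1 (mem_range_self y)
  linarith

lemma lower (D : HData H Hstar t₀ A α) (y : ℝ) : y ^ 2 / 4 ≤ H y ∨ t₀ ^ 2 ≤ H y := by
  rcases le_or_gt |y| (2 * t₀) with h | h
  · exact Or.inl (D.quad y h).ge
  · right
    have h1 : H (2 * t₀) ≤ H y := D.mono_abs (by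
      rw [abs_of_pos (by linarith [D.ht₀] : 0 < 2 * t₀)]; exact h.le)
    rw [D.quad (2 * t₀) (by rw [abs_of_pos (by linarith [D.ht₀])])] at h1
    linarith

lemma star_nonneg (D : HData H Hstar t₀ A α) (x : ℝ) : 0 ≤ Hstar x := by
  have := D.young x 0
  rw [D.zero] at this
  linarith

lemma star_mono (D : HData H Hstar t₀ A α) {x y : ℝ} (hxy : x ≤ y) (hx : 0 ≤ x) :
    Hstar x ≤ Hstar y := by
  refine (D.star x).2 ?_
  rintro _ ⟨z, rfl⟩
  simp only
  have h1 := D.young y |z|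
  rw [D.abs_eq] at h1
  have h2 : x * z ≤ x * |z| := mul_le_mul_of_nonneg_left (le_abs_self z) hx
  have h3 : x * |z| ≤ y * |z| := mul_le_mul_of_nonneg_right hxy (abs_nonneg z)
  linarith

lemma star_scale (D : HData H Hstar t₀ A α) {k : ℝ} (hk : 0 ≤ k) (hk1 : k ≤ 1) (x : ℝ) :
    Hstar (k * x) ≤ k * Hstar x := by
  refine (D.star _).2 ?_
  rintro _ ⟨z, rfl⟩
  simp only
  have h1 := D.young x z
  have h2 := D.nn z
  have h3 := mul_le_mul_of_nonneg_left h1 hk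
  nlinarith

lemma star_le (D : HData H Hstar t₀ A α) {x B : ℝ} (hx : 0 ≤ x)
    (h : ∀ y ≥ 0, x * y ≤ H y + B) : Hstar x ≤ B := by
  refine (D.star x).2 ?_
  rintro _ ⟨z, rfl⟩
  simp only
  have h1 := h |z| (abs_nonneg z)
  rw [D.abs_eq] at h1
  have h2 : x * z ≤ x * |z| := mul_le_mul_of_nonneg_left (le_abs_self z) hx
  linarith

lemma star_set_nonempty (D : HData H Hstar t₀ A α) (u : ℝ) :
    {t : ℝ | 0 ≤ t ∧ u ≤ Hstar t}.Nonempty := by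
  obtain ⟨t, ht, ht1⟩ := ((D.super.eventually (eventually_ge_atTop |u|)).and
    (eventually_ge_atTop (1:ℝ))).exists
  refine ⟨t, by linarith, ?_⟩
  rw [le_div_iff₀ (by linarith)] at ht
  nlinarith [le_abs_self u, abs_nonneg u]

lemma cinv_nonneg (u : ℝ) : 0 ≤ cinv Hstar u := Real.sInf_nonneg fun _ ht => ht.1

lemma mul_cinv_le (D : HData H Hstar t₀ A α) {a u : ℝ} (ha : 0 ≤ a) (hu : 0 < u) :
    a * cinv Hstar u ≤ H a + u := by
  by_contra! hc
  have hHa := D.nn a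
  have ha0 : 0 < a := by
    rcases ha.eq_or_lt with rfl | h
    · simp at hc; linarith
    · exact h
  have ht : (H a + u) / a < cinv Hstar u := by rw [div_lt_iff₀ ha0]; linarith
  have hnot := notMem_of_lt_csInf ht ⟨0, fun _ h => h.1⟩
  have ht0 : 0 ≤ (H a + u) / a := by positivity
  have hlt : Hstar ((H a + u) / a) < u := by
    by_contra! h
    exact hnot ⟨ht0, h⟩
  have := D.young ((H a + u) / a) a
  rw [div_mul_cancel₀ _ ha0.ne'] at this
  linarith

lemma le_cinv (D : HData H Hstar t₀ A α) {r u : ℝ} (hr : Hstar r < u) : r ≤ cinv Hstar u := by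
  refine le_csInf (D.star_set_nonempty u) ?_
  rintro t ⟨ht0, ht⟩
  by_contra! h
  have := D.star_mono h.le ht0
  linarith

end HData

end HFacts

section TwoSided

/-- The data entering the two-sided estimate: a monotone map `U`, a convex function `φ` with
derivative `g`, and a cost `S`. -/
structure Sys (U φ g S : ℝ → ℝ) (D : ℝ) : Prop where
  mono : Monotone U
  tan : ∀ x y, φ x + g x * (y - x) ≤ φ y
  mφ : Measurable φ
  mg : Measurable g
  mS : Measurable S
  nn : ∀ p, 0 ≤ S p
  zero : S 0 = 0
  even : ∀ p, S (-p) = S p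
  hD : 1 ≤ D
  hW : ∀ x y, x ≤ y → U y - U x ≤ D * (1 + (y - x))
  small : ∀ p ≥ 0, 2 * D * p ≤ 1 / 100 → (2 * D * p) ^ 2 ≤ S p
  big : ∀ p ≥ 0, 1 / 100 < 2 * D * p → 1 ≤ S p
  h3 : ∀ p ≥ 0, 1 / 100 < 2 * D * p → ∀ x y, x < y → p * (U y - U x) ≤ (S p + (y - x)) / 2

variable {U φ g S : ℝ → ℝ} {D : ℝ}

namespace Sys

lemma reflect (h : Sys U φ g S D) :
    Sys (fun x => - U (-x)) (fun y => φ (-y)) (fun y => - g (-y)) S D where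
  mono := fun x y hxy => neg_le_neg (h.mono (neg_le_neg hxy))
  tan := fun x y => by
    have := h.tan (-x) (-y)
    try simp only
    linarith
  mφ := h.mφ.comp measurable_neg
  mg := (h.mg.comp measurable_neg).neg
  mS := h.mS
  nn := h.nn
  zero := h.zero
  even := h.even
  hD := h.hD
  hW := fun x y hxy => by
    have := h.hW (-y) (-x) (by linarith)
    try simp only
    linarith
  small := h.small
  big := h.big
  h3 := fun p hp hp' x y hxy => by
    have := h.h3 p hp hp' (-y) (-x) (by linarith)
    try simp only
    linarith

lemma g_mono (h : Sys U φ g S D) : Monotone g := by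
  intro x y hxy
  rcases hxy.eq_or_lt with rfl | hlt
  · exact le_rfl
  have h1 := h.tan x y
  have h2 := h.tan y x
  by_contra! hc
  nlinarith

lemma one_side (h : Sys U φ g S D) :
    ∫⁻ x in Ioi 0, ENNReal.ofReal (psiE (max (φ (U x) - φ (U 0)) 0) * Real.exp (-x)) ≤
      ENNReal.ofReal CH *
        ∫⁻ x in Ioi 0, ENNReal.ofReal (S (g (U x)) * Real.exp (φ (U x) - φ (U 0)) * Real.exp (-x)) := by
  classical
  have mU : Measurable U := h.mono.measurable
  have mφU : Measurable fun x => φ (U x) := h.mφ.comp mU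
  have mgU : Measurable fun x => g (U x) := h.mg.comp mU
  have hD := h.hD
  set a := φ (U 0) with ha
  have hset : MeasurableSet {x | a < φ (U x)} := measurableSet_lt measurable_const mφU
  -- positivity of the slope above level `a`
  have hgpos : ∀ x ≥ 0, a < φ (U x) → 0 ≤ g (U x) := by
    intro x hx hax
    have h1 := h.tan (U x) (U 0)
    have h2 := h.mono hx
    by_contra! hc
    nlinarith
  have hstep : ∀ x y, x ≤ y → φ (U y) - φ (U x) ≤ g (U y) * (U y - U x) := by
    intro x y _
    have h1 := h.tan (U y) (U x)
    linarith
  have hinc : ∀ x y, 0 ≤ x → x ≤ y → a < φ (U x) → φ (U x) ≤ φ (U y) := by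
    intro x y hx hxy hax
    have h1 := h.tan (U x) (U y)
    have h2 := mul_nonneg (hgpos x hx hax) (sub_nonneg.2 (h.mono hxy))
    linarith
  have hgm : ∀ x y, x ≤ y → g (U x) ≤ g (U y) := fun x y hxy => h.g_mono (h.mono hxy)
  have key := half_line (fun x => max (φ (U x) - a) 0)
    (fun x => if a < φ (U x) then 2 * D * g (U x) else 0)
    (fun x => if a < φ (U x) then S (g (U x)) else 0)
    ((mφU.sub_const a).max measurable_const)
    (Measurable.ite hset (mgU.const_mul _) measurable_const)
    (Measurable.ite hset (h.mS.comp mgU) measurable_const)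
    (fun x _ => le_max_right _ _)
    (fun x hx => by
      try simp only
      split_ifs with hc
      · have := hgpos x (le_of_lt hx) hc
        positivity
      · exact le_rfl)
    (fun x hx => by
      try simp only
      split_ifs with hc
      · exact h.nn _
      · exact le_rfl)
    (fun x hx y hy hxy => by
      try simp only
      rcases le_or_gt (φ (U x)) a with hc | hc
      · rw [max_eq_right (by linarith)]
        exact le_max_right _ _
      · have := hinc x y (le_of_lt hx) hxy hc
        exact max_le_max (by linarith) le_rfl)
    (fun x hx y hy hxy => by
      try simp only
      by_cases hc : a < φ (U x)
      · have := hinc x y (le_of_lt hx) hxy hc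
        rw [if_pos hc, if_pos (hc.trans_le this)]
        have := hgm x y hxy
        gcongr
      · rw [if_neg hc]
        split_ifs with hc2
        · have := hgpos y (le_of_lt hy) hc2
          positivity
        · exact le_rfl)
    (fun x hx hx1 => by
      try simp only
      by_cases hc : a < φ (U x)
      · rw [if_pos hc, max_eq_left (by linarith)]
        have h1 := hstep 0 x (le_of_lt hx)
        have h2 := h.hW 0 x (le_of_lt hx)
        have h3 := hgpos x (le_of_lt hx) hc
        have h4 : g (U x) * (U x - U 0) ≤ g (U x) * (2 * D) := by
          apply mul_le_mul_of_nonneg_left _ h3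
          nlinarith
        linarith
      · rw [if_neg hc, max_eq_right (by linarith)])
    (fun x hx => by
      try simp only
      by_cases hc : a < φ (U x)
      · rw [if_pos hc, max_eq_left (by linarith)]
        have h1 := hstep (x-1) x (by linarith)
        have h2 := h.hW (x-1) x (by linarith)
        have h3 := hgpos x (by linarith) hc
        have h4 : g (U x) * (U x - U (x-1)) ≤ g (U x) * (2 * D) := by
          apply mul_le_mul_of_nonneg_left _ h3
          nlinarith
        have h5 := le_max_left (φ (U (x-1)) - a) 0
        linarith
      · rw [if_neg hc, max_eq_right (by linarith)]
        have h5 := le_max_right (φ (U (x-1)) - a) 0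
        linarith)
    (fun x hx hd => by
      try simp only at hd ⊢
      by_cases hc : a < φ (U x)
      · rw [if_pos hc] at hd ⊢
        rw [if_pos hc]
        exact h.small _ (hgpos x (le_of_lt hx) hc) hd
      · rw [if_neg hc, if_neg hc]; norm_num)
    (fun x hx hd => by
      try simp only at hd ⊢
      by_cases hc : a < φ (U x)
      · rw [if_pos hc] at hd ⊢
        exact h.big _ (hgpos x (le_of_lt hx) hc) hd
      · rw [if_neg hc] at hd; norm_num at hd)
    (fun x y hy hyx hd => by
      try simp only at hd ⊢
      by_cases hc : a < φ (U x)
      · rw [if_pos hc] at hd ⊢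
        rw [max_eq_left (by linarith)]
        have h1 := hstep y x hyx.le
        have h2 := h.h3 _ (hgpos x (hy.trans hyx).le hc) hd y x hyx
        have h5 := le_max_left (φ (U y) - a) 0
        linarith
      · rw [if_neg hc] at hd; norm_num at hd)
    (fun x hx hd => by
      try simp only at hd ⊢
      by_cases hc : a < φ (U x)
      · rw [if_pos hc] at hd ⊢
        rw [max_eq_left (by linarith)]
        have h1 := hstep 0 x (le_of_lt hx)
        have h2 := h.h3 _ (hgpos x (le_of_lt hx) hc) hd 0 x hx
        linarith
      · rw [if_neg hc] at hd; norm_num at hd)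
  refine key.trans (mul_le_mul' le_rfl (lintegral_mono fun x => ENNReal.ofReal_le_ofReal ?_))
  try simp only
  by_cases hc : a < φ (U x)
  · rw [if_pos hc, max_eq_left (by linarith)]
  · rw [if_neg hc]
    have := h.nn (g (U x))
    simp only [zero_mul]
    positivity

lemma sq_le_exp {x : ℝ} (hx : 0 ≤ x) : (1 + x) ^ 2 ≤ 16 * Real.exp (x / 2) := by
  have h1 := Real.add_one_le_exp (x / 4)
  have h2 : Real.exp (x / 2) = Real.exp (x / 4) ^ 2 := by
    rw [← Real.exp_nat_mul]; congr 1; push_cast; ring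
  rw [h2]
  nlinarith [Real.exp_pos (x/4)]

/-- The part of the left half-line where `φ` is below the central value. -/
lemma remainder (h : Sys U φ g S D) (h0 : 0 ≤ g (U 0)) :
    ∫⁻ x in Ioi 0, ENNReal.ofReal (psiE (min (φ (U (-x)) - φ (U 0)) 0) * Real.exp (-x)) ≤
      ENNReal.ofReal 32 *
        ∫⁻ x in Ioi 0, ENNReal.ofReal (S (g (U x)) * Real.exp (φ (U x) - φ (U 0)) * Real.exp (-x)) := by
  have hD := h.hD
  set d₀ := 2 * D * g (U 0) with hd₀
  have hd0 : 0 ≤ d₀ := by positivity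
  set m := min 1 (d₀ ^ 2) with hm
  have hm0 : 0 ≤ m := le_min zero_le_one (sq_nonneg _)
  have hlow : ENNReal.ofReal m ≤
      ∫⁻ x in Ioi 0, ENNReal.ofReal (S (g (U x)) * Real.exp (φ (U x) - φ (U 0)) * Real.exp (-x)) := by
    have h1 := lintegral_exp_Ioi 0 (k := 1) one_pos
    simp only [one_mul, mul_zero, neg_zero, Real.exp_zero, div_one, ENNReal.ofReal_one] at h1
    calc ENNReal.ofReal m = ENNReal.ofReal m * ∫⁻ x in Ioi (0:ℝ), ENNReal.ofReal (Real.exp (-x)) := by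
          rw [h1, mul_one]
      _ = ∫⁻ x in Ioi (0:ℝ), ENNReal.ofReal m * ENNReal.ofReal (Real.exp (-x)) :=
          (lintegral_const_mul' _ _ ENNReal.ofReal_ne_top).symm
      _ ≤ _ := by
          refine setLIntegral_mono' measurableSet_Ioi fun x hx => ?_
          have hx0 : (0:ℝ) ≤ x := le_of_lt hx
          rw [← ENNReal.ofReal_mul hm0]
          apply ENNReal.ofReal_le_ofReal
          have hg : g (U 0) ≤ g (U x) := h.g_mono (h.mono hx0)
          have hS : m ≤ S (g (U x)) := by
            rcases le_or_gt (2 * D * g (U x)) (1/100) with hc | hc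
            · refine le_trans (min_le_right _ _) (le_trans ?_ (h.small _ (h0.trans hg) hc))
              have : d₀ ≤ 2 * D * g (U x) := by rw [hd₀]; gcongr
              gcongr
            · exact le_trans (min_le_left _ _) (h.big _ (h0.trans hg) hc)
          have hu : 0 ≤ φ (U x) - φ (U 0) := by
            have := h.tan (U 0) (U x)
            have := mul_nonneg h0 (sub_nonneg.2 (h.mono hx0))
            linarith
          have := Real.one_le_exp hu
          have : m ≤ S (g (U x)) * Real.exp (φ (U x) - φ (U 0)) := by nlinarith
          gcongr
  refine le_trans ?_ (mul_le_mul' le_rfl hlow)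
  rw [← ENNReal.ofReal_mul (by norm_num)]
  have h2 := lintegral_exp_Ioi 0 (k := 1/2) (by norm_num)
  simp only [mul_zero, neg_zero, Real.exp_zero] at h2
  calc _ ≤ ∫⁻ x in Ioi (0:ℝ), ENNReal.ofReal (16 * m) * ENNReal.ofReal (Real.exp (-(1/2*x))) := by
        refine setLIntegral_mono' measurableSet_Ioi fun x hx => ?_
        have hx0 : (0:ℝ) ≤ x := le_of_lt hx
        rw [← ENNReal.ofReal_mul (by positivity)]
        apply ENNReal.ofReal_le_ofReal
        set u := min (φ (U (-x)) - φ (U 0)) 0 with hu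
        have hu0 : u ≤ 0 := min_le_right _ _
        have hul : - (d₀ * (1 + x)) ≤ u := by
          refine le_min ?_ ?_
          · have h3 := h.tan (U 0) (U (-x))
            have h4 := h.hW (-x) 0 (by linarith)
            have h5 : g (U 0) * (U 0 - U (-x)) ≤ g (U 0) * (D * (1 + (0 - -x))) :=
              mul_le_mul_of_nonneg_left h4 h0
            have h6 : 0 ≤ D * g (U 0) * (1 + x) := by positivity
            simp only [hd₀]
            nlinarith
          · have : 0 ≤ d₀ * (1 + x) := by positivity
            linarith
        obtain ⟨p1, p2⟩ := psiE_le_of_nonpos hu0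
        have hpsi : psiE u ≤ m * (1 + x) ^ 2 := by
          have q1 : 1 ≤ (1 + x) ^ 2 := by nlinarith
          have q2 : u ^ 2 ≤ d₀ ^ 2 * (1 + x) ^ 2 := by rw [← mul_pow]; nlinarith
          rcases le_total 1 (d₀ ^ 2) with hc | hc
          · rw [hm, min_eq_left hc]; linarith
          · rw [hm, min_eq_right hc]; linarith
        have hs := sq_le_exp hx0
        have he : Real.exp (-(1/2 * x)) = Real.exp (x/2) * Real.exp (-x) := by
          rw [← Real.exp_add]; ring_nf
        rw [he]
        calc psiE u * Real.exp (-x) ≤ (m * (16 * Real.exp (x/2))) * Real.exp (-x) := by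
              gcongr
              refine hpsi.trans ?_
              gcongr
          _ = _ := by ring
    _ = ENNReal.ofReal (32 * m) := by
        rw [lintegral_const_mul' _ _ ENNReal.ofReal_ne_top, h2, ← ENNReal.ofReal_mul (by positivity)]
        congr 1; ring

lemma psiE_split (t : ℝ) : psiE t = psiE (max t 0) + psiE (min t 0) := by
  have h0 : psiE 0 = 0 := by simp [psiE]
  rcases le_total t 0 with h | h
  · rw [max_eq_right h, min_eq_left h, h0, zero_add]
  · rw [max_eq_left h, min_eq_right h, h0, add_zero]

lemma two_sided_aux (h : Sys U φ g S D) (h0 : 0 ≤ g (U 0)) :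
    (∫⁻ x in Ioi 0, ENNReal.ofReal (psiE (φ (U x) - φ (U 0)) * Real.exp (-x))) +
    (∫⁻ x in Ioi 0, ENNReal.ofReal (psiE (φ (U (-x)) - φ (U 0)) * Real.exp (-x))) ≤
      ENNReal.ofReal (CH + 32) *
      ((∫⁻ x in Ioi 0,
          ENNReal.ofReal (S (g (U x)) * Real.exp (φ (U x) - φ (U 0)) * Real.exp (-x))) +
        ∫⁻ x in Ioi 0,
          ENNReal.ofReal (S (g (U (-x))) * Real.exp (φ (U (-x)) - φ (U 0)) * Real.exp (-x))) := by
  have hCH : 0 ≤ CH := by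
    have := CE_ge
    unfold CH
    positivity
  have mU : Measurable U := h.mono.measurable
  have mφU : Measurable fun x => φ (U (-x)) := h.mφ.comp (mU.comp measurable_neg)
  have hR := h.one_side
  have hL := h.reflect.one_side
  have hM := h.remainder h0
  simp only [neg_neg, neg_zero, h.even] at hL
  set J1 := ∫⁻ x in Ioi (0:ℝ),
    ENNReal.ofReal (S (g (U x)) * Real.exp (φ (U x) - φ (U 0)) * Real.exp (-x))
  set J2 := ∫⁻ x in Ioi (0:ℝ),
    ENNReal.ofReal (S (g (U (-x))) * Real.exp (φ (U (-x)) - φ (U 0)) * Real.exp (-x))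
  have e1 : (∫⁻ x in Ioi 0, ENNReal.ofReal (psiE (φ (U x) - φ (U 0)) * Real.exp (-x))) ≤
      ENNReal.ofReal CH * J1 := by
    refine le_trans (setLIntegral_mono' measurableSet_Ioi fun x hx => ?_) hR
    have hu : 0 ≤ φ (U x) - φ (U 0) := by
      have := h.tan (U 0) (U x)
      have := mul_nonneg h0 (sub_nonneg.2 (h.mono (le_of_lt hx)))
      linarith
    rw [max_eq_left hu]
  have e2 : (∫⁻ x in Ioi 0, ENNReal.ofReal (psiE (φ (U (-x)) - φ (U 0)) * Real.exp (-x))) ≤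
      ENNReal.ofReal CH * J2 + ENNReal.ofReal 32 * J1 := by
    refine le_trans ?_ (add_le_add hL hM)
    rw [← lintegral_add_left]
    · refine lintegral_mono fun x => ?_
      rw [← ENNReal.ofReal_add (mul_nonneg (psiE_nonneg _) (Real.exp_pos _).le)
        (mul_nonneg (psiE_nonneg _) (Real.exp_pos _).le), ← add_mul, ← psiE_split]
    · have mm : Measurable fun x => max (φ (U (-x)) - φ (U 0)) 0 :=
        (mφU.sub_const _).max measurable_const
      unfold psiE
      exact (((mm.mul mm.exp).sub mm.exp).add_const 1).mul
        (measurable_neg.exp) |>.ennreal_ofReal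
  calc _ ≤ ENNReal.ofReal CH * J1 + (ENNReal.ofReal CH * J2 + ENNReal.ofReal 32 * J1) :=
        add_le_add e1 e2
    _ ≤ ENNReal.ofReal CH * J1 + (ENNReal.ofReal CH * J2 + ENNReal.ofReal 32 * J1)
        + ENNReal.ofReal 32 * J2 := le_self_add
    _ = _ := by
        rw [ENNReal.ofReal_add hCH (by norm_num)]; ring

lemma two_sided (h : Sys U φ g S D) :
    (∫⁻ x in Ioi 0, ENNReal.ofReal (psiE (φ (U x) - φ (U 0)) * Real.exp (-x))) +
    (∫⁻ x in Ioi 0, ENNReal.ofReal (psiE (φ (U (-x)) - φ (U 0)) * Real.exp (-x))) ≤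
      ENNReal.ofReal (CH + 32) *
      ((∫⁻ x in Ioi 0,
          ENNReal.ofReal (S (g (U x)) * Real.exp (φ (U x) - φ (U 0)) * Real.exp (-x))) +
        ∫⁻ x in Ioi 0,
          ENNReal.ofReal (S (g (U (-x))) * Real.exp (φ (U (-x)) - φ (U 0)) * Real.exp (-x))) := by
  rcases le_total 0 (g (U 0)) with h0 | h0
  · exact h.two_sided_aux h0
  · have := h.reflect.two_sided_aux (by simpa using h0)
    simp only [neg_neg, neg_zero, h.even] at this
    rw [add_comm, add_comm (∫⁻ x in Ioi 0,
          ENNReal.ofReal (S (g (U x)) * Real.exp (φ (U x) - φ (U 0)) * Real.exp (-x)))]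
    exact this

end Sys

end TwoSided

section Backward

lemma convex_tangent {φ : ℝ → ℝ} (hd : Differentiable ℝ φ) (hc : ConvexOn ℝ univ φ) (x y : ℝ) :
    φ x + deriv φ x * (y - x) ≤ φ y := by
  rcases lt_trichotomy x y with h | rfl | h
  · have := hc.deriv_le_slope (mem_univ x) (mem_univ y) h (hd x)
    rw [slope_def_field, le_div_iff₀ (by linarith)] at this
    linarith
  · simp
  · have := hc.slope_le_deriv (mem_univ y) (mem_univ x) h (hd x)
    rw [slope_def_field, div_le_iff₀ (by linarith)] at this
    linarith

/-- Integrability facts for a Lipschitz function under exponential moments. -/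
lemma lip_integrable {μ : Measure ℝ} [IsProbabilityMeasure μ]
    (hexp : ∀ s > (0:ℝ), Integrable (fun x => Real.exp (s * |x|)) μ)
    {φ : ℝ → ℝ} {K : ℝ≥0} (hK : LipschitzWith K φ) :
    Integrable (fun x => Real.exp (φ x)) μ ∧ Integrable (fun x => Real.exp (φ x) * φ x) μ := by
  have hcont := hK.continuous
  have hb : ∀ x, |φ x| ≤ |φ 0| + (K + 1) * |x| := by
    intro x
    have := hK.dist_le_mul x 0
    rw [Real.dist_eq, Real.dist_eq, sub_zero] at this
    have h2 := abs_sub_abs_le_abs_sub (φ x) (φ 0)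
    have := abs_nonneg x
    nlinarith
  have hi : Integrable (fun x => Real.exp (2 * |φ 0|) * Real.exp ((2 * (K + 1)) * |x|)) μ :=
    (hexp (2 * (K + 1)) (by positivity)).const_mul _
  have hle : ∀ x, Real.exp (2 * |φ x|) ≤ Real.exp (2 * |φ 0|) * Real.exp ((2 * (K + 1)) * |x|) := by
    intro x
    rw [← Real.exp_add]
    exact Real.exp_le_exp.2 (by linarith [hb x])
  constructor
  · refine hi.mono' (by fun_prop) (Eventually.of_forall fun x => ?_)
    rw [Real.norm_of_nonneg (Real.exp_pos _).le]
    refine le_trans (Real.exp_le_exp.2 ?_) (hle x)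
    linarith [le_abs_self (φ x), abs_nonneg (φ x)]
  · refine hi.mono' (by fun_prop) (Eventually.of_forall fun x => ?_)
    rw [norm_mul, Real.norm_of_nonneg (Real.exp_pos _).le, Real.norm_eq_abs]
    refine le_trans ?_ (hle x)
    have h1 : |φ x| ≤ Real.exp |φ x| := by linarith [Real.add_one_le_exp |φ x|]
    have h2 : Real.exp (φ x) ≤ Real.exp |φ x| := Real.exp_le_exp.2 (le_abs_self _)
    calc Real.exp (φ x) * |φ x| ≤ Real.exp |φ x| * Real.exp |φ x| := by gcongr
      _ = Real.exp (2 * |φ x|) := by rw [← Real.exp_add]; ring_nf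

/-- Variational bound of the entropy. -/
lemma Ent_exp_le {μ : Measure ℝ} [IsProbabilityMeasure μ]
    (hexp : ∀ s > (0:ℝ), Integrable (fun x => Real.exp (s * |x|)) μ)
    {φ : ℝ → ℝ} {K : ℝ≥0} (hK : LipschitzWith K φ) (a : ℝ) :
    Ent μ (fun x => Real.exp (φ x)) ≤
      ENNReal.ofReal (Real.exp a) * ∫⁻ x, ENNReal.ofReal (psiE (φ x - a)) ∂μ := by
  obtain ⟨i1, i2⟩ := lip_integrable hexp hK
  have hcont := hK.continuous
  unfold Ent
  have i2' : Integrable (fun x => Real.exp (φ x) * Real.log (Real.exp (φ x))) μ := by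
    simpa only [Real.log_exp] using i2
  rw [if_pos i2']
  simp only [Real.log_exp]
  set Z := ∫ x, Real.exp (φ x) ∂μ with hZ
  have hZpos : 0 < Z := integral_exp_pos i1
  have hpt : ∀ x, Real.exp a * psiE (φ x - a) =
      Real.exp (φ x) * φ x - (a + 1) * Real.exp (φ x) + Real.exp a := by
    intro x
    have : Real.exp (φ x) = Real.exp a * Real.exp (φ x - a) := by rw [← Real.exp_add]; ring_nf
    rw [this]; unfold psiE; ring
  have hInte : Integrable (fun x => Real.exp a * psiE (φ x - a)) μ := by
    simp_rw [hpt]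
    exact (i2.sub (i1.const_mul _)).add (integrable_const _)
  have heq : ∫ x, Real.exp a * psiE (φ x - a) ∂μ =
      (∫ x, Real.exp (φ x) * φ x ∂μ) - (a + 1) * Z + Real.exp a := by
    simp_rw [hpt]
    have i3 : Integrable (fun x => Real.exp (φ x) * φ x - (a + 1) * Real.exp (φ x)) μ :=
      i2.sub (i1.const_mul _)
    rw [integral_add i3 (integrable_const _),
      integral_sub i2 (i1.const_mul _), integral_const_mul]
    simp [hZ]
  have hl : ENNReal.ofReal (Real.exp a) * ∫⁻ x, ENNReal.ofReal (psiE (φ x - a)) ∂μ =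
      ∫⁻ x, ENNReal.ofReal (Real.exp a * psiE (φ x - a)) ∂μ := by
    rw [← lintegral_const_mul' _ _ ENNReal.ofReal_ne_top]
    congr 1; ext x
    rw [ENNReal.ofReal_mul (Real.exp_pos _).le]
  rw [hl, ← ofReal_integral_eq_lintegral_ofReal hInte
    (Eventually.of_forall fun x => mul_nonneg (Real.exp_pos _).le (psiE_nonneg _)), heq]
  apply ENNReal.ofReal_le_ofReal
  have hψ := psiE_nonneg (Real.log Z - a)
  have hE : Real.exp a * psiE (Real.log Z - a) = Z * Real.log Z - (a + 1) * Z + Real.exp a := by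
    have : Z = Real.exp a * Real.exp (Real.log Z - a) := by
      rw [← Real.exp_add]
      rw [add_sub_cancel, Real.exp_log hZpos]
    have h2 : Real.exp a * psiE (Real.log Z - a) =
      (Real.exp a * Real.exp (Real.log Z - a)) * Real.log Z
        - (a + 1) * (Real.exp a * Real.exp (Real.log Z - a)) + Real.exp a := by
      unfold psiE; ring
    rw [← this] at h2
    exact h2
  have := mul_nonneg (Real.exp_pos a).le hψ
  linarith

variable {H Hstar : ℝ → ℝ} {t₀ A α : ℝ}

lemma delta_young (D : HData H Hstar t₀ A α) {U : ℝ → ℝ} {b : ℝ} (hb : 0 < b)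
    (hU : ∀ h > (0:ℝ), ∀ x : ℝ, U (x + h) - U x ≤ (1 / b) * cinv Hstar (t₀ ^ 2 + h))
    {a : ℝ} (ha : 0 ≤ a) {x y : ℝ} (hxy : x < y) :
    a * (U y - U x) ≤ (1 / b) * (H a + t₀ ^ 2 + (y - x)) := by
  have h1 := hU (y - x) (by linarith) x
  rw [add_sub_cancel] at h1
  have h2 := D.mul_cinv_le ha (u := t₀ ^ 2 + (y - x)) (by nlinarith [D.ht₀])
  calc a * (U y - U x) ≤ a * ((1 / b) * cinv Hstar (t₀ ^ 2 + (y - x))) := by gcongr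
    _ = (1 / b) * (a * cinv Hstar (t₀ ^ 2 + (y - x))) := by ring
    _ ≤ (1 / b) * (H a + (t₀ ^ 2 + (y - x))) := by gcongr
    _ = _ := by ring

lemma backward_exp (D : HData H Hstar t₀ A α) (μ : Measure ℝ) [IsProbabilityMeasure μ]
    {b : ℝ} (hb : 0 < b)
    (hU : ∀ h > (0:ℝ), ∀ x : ℝ,
      Umap μ (x + h) - Umap μ x ≤ (1 / b) * cinv Hstar (t₀ ^ 2 + h)) :
    ∀ s > (0:ℝ), Integrable (fun x => Real.exp (s * |x|)) μ := by
  intro s hs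
  refine ⟨by fun_prop, ?_⟩
  rw [hasFiniteIntegral_iff_ofReal (Eventually.of_forall fun x => (Real.exp_pos _).le)]
  rw [lintegral_Umap μ (fun y => ENNReal.ofReal (Real.exp (s * |y|))) (by fun_prop)]
  set U := Umap μ with hUdef
  set C := s * |U 0| + (H (2 * s / b) + t₀ ^ 2) / 2 with hC
  have hgrow : ∀ x y, x < y → s * (U y - U x) ≤ (H (2 * s / b) + t₀ ^ 2 + (y - x)) / 2 := by
    intro x y hxy
    have := delta_young D hb hU (a := 2 * s / b) (by positivity) hxy
    have h2 : s * (U y - U x) = (b / 2) * (2 * s / b * (U y - U x)) := by field_simp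
    rw [h2]
    calc _ ≤ (b / 2) * ((1 / b) * (H (2 * s / b) + t₀ ^ 2 + (y - x))) := by gcongr
      _ = _ := by field_simp
  have hm : Monotone U := Umap_mono μ
  have hbd : ∀ x > 0, s * |U x| ≤ C + x / 2 ∧ s * |U (-x)| ≤ C + x / 2 := by
    intro x hx
    constructor
    · have h1 := hgrow 0 x hx
      have h2 := hm hx.le
      have h3 : |U x| ≤ |U 0| + (U x - U 0) := by
        rw [abs_le]
        constructor <;> linarith [le_abs_self (U 0), neg_abs_le (U 0)]
      have h4 := mul_le_mul_of_nonneg_left h3 hs.le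
      rw [hC]; linarith
    · have h1 := hgrow (-x) 0 (by linarith)
      have h2 := hm (by linarith : -x ≤ 0)
      have h3 : |U (-x)| ≤ |U 0| + (U 0 - U (-x)) := by
        rw [abs_le]
        constructor <;> linarith [le_abs_self (U 0), neg_abs_le (U 0)]
      have h4 := mul_le_mul_of_nonneg_left h3 hs.le
      rw [hC]; linarith
  have hfin : ∀ V : ℝ → ℝ, (∀ x > 0, s * |V x| ≤ C + x / 2) →
      ∫⁻ x in Ioi (0:ℝ), ENNReal.ofReal (Real.exp (-x) / 2) *
        ENNReal.ofReal (Real.exp (s * |V x|)) < ⊤ := by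
    intro V hV
    have h2 := lintegral_exp_Ioi 0 (k := 1/2) (by norm_num)
    refine lt_of_le_of_lt (b := ∫⁻ x in Ioi (0:ℝ), ENNReal.ofReal (Real.exp C) *
      ENNReal.ofReal (Real.exp (-(1/2*x)))) ?_ ?_
    · refine setLIntegral_mono' measurableSet_Ioi fun x hx => ?_
      rw [← ENNReal.ofReal_mul (by positivity), ← ENNReal.ofReal_mul (by positivity)]
      apply ENNReal.ofReal_le_ofReal
      have h3 : Real.exp (s * |V x|) ≤ Real.exp (C + x / 2) := Real.exp_le_exp.2 (hV x hx)
      calc Real.exp (-x) / 2 * Real.exp (s * |V x|) ≤ Real.exp (-x) * Real.exp (C + x / 2) := by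
            gcongr
            linarith [Real.exp_pos (-x)]
        _ = _ := by rw [← Real.exp_add, ← Real.exp_add]; ring_nf
    · rw [lintegral_const_mul' _ _ ENNReal.ofReal_ne_top, h2]
      exact ENNReal.mul_lt_top ENNReal.ofReal_lt_top ENNReal.ofReal_lt_top
  exact ENNReal.add_lt_top.2 ⟨hfin U fun x hx => (hbd x hx).1,
    hfin (fun x => U (-x)) fun x hx => (hbd x hx).2⟩

set_option maxHeartbeats 1600000 in
lemma backward (D : HData H Hstar t₀ A α) (μ : Measure ℝ) [IsProbabilityMeasure μ]
    {b : ℝ} (hb : 0 < b)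
    (hU : ∀ h > (0:ℝ), ∀ x : ℝ,
      Umap μ (x + h) - Umap μ x ≤ (1 / b) * cinv Hstar (t₀ ^ 2 + h)) :
    ∃ c > (0:ℝ), ∀ φ : ℝ → ℝ, ContDiff ℝ (⊤ : ℕ∞) φ → ConvexOn ℝ Set.univ φ →
        (∃ K : ℝ≥0, LipschitzWith K φ) →
        Ent μ (fun x => Real.exp (φ x)) ≤
          ∫⁻ x, ENNReal.ofReal (H (c * deriv φ x) * Real.exp (φ x)) ∂μ := by
  have hexp := backward_exp D μ hb hU
  have ht₀ := D.ht₀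
  have hs1 := D.star_nonneg 1
  have hH1 := D.nn 1
  set D₀ := 1 + (1 / b) * (1 + H 1 + t₀ ^ 2) with hD₀
  have hD1 : 1 ≤ D₀ := by
    have : 0 ≤ (1 / b) * (1 + H 1 + t₀ ^ 2) := by positivity
    linarith
  set c := 2 / b + 200 * D₀ * (1 + Hstar 1) with hc
  set C₁ := 1 + t₀ ^ 2 + 1 / t₀ ^ 2 with hC₁
  have hCt : 1 ≤ C₁ * t₀ ^ 2 := by
    have : 1 / t₀ ^ 2 * t₀ ^ 2 = 1 := by field_simp
    rw [hC₁]; nlinarith [sq_nonneg t₀, sq_nonneg (t₀ ^ 2)]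
  have hC1 : 1 + t₀ ^ 2 ≤ C₁ := by
    have : 0 ≤ 1 / t₀ ^ 2 := by positivity
    linarith
  have hC1' : 1 ≤ C₁ := by nlinarith
  have hbp : 0 < 2 / b := by positivity
  have hc1 : 2 / b ≤ c := by
    have : 0 ≤ 200 * D₀ * (1 + Hstar 1) := by positivity
    linarith
  have hc2 : 200 * D₀ * (1 + Hstar 1) ≤ c := by linarith
  have hc3 : 4 * D₀ ≤ c := by nlinarith
  have hc0 : 0 < c := by linarith
  have hlow : ∀ p ≥ 0, 1 / 100 < 2 * D₀ * p → 1 ≤ H (c * p) := by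
    intro p hp hlt
    have h1 := D.young 1 (c * p)
    have h2 : 200 * D₀ * (1 + Hstar 1) * p ≤ c * p := by gcongr
    nlinarith
  have hCH : 0 ≤ CH := by
    have := CE_ge
    unfold CH
    positivity
  set C₂ := (CH + 32) * C₁ with hC₂
  have hC21 : 1 ≤ C₂ := by rw [hC₂]; nlinarith
  refine ⟨C₂ * c, by positivity, fun φ hφ hconv hlip => ?_⟩
  obtain ⟨K, hK⟩ := hlip
  have hdiff : Differentiable ℝ φ := hφ.differentiable (by simp)
  have hdc : Continuous (deriv φ) := hφ.continuous_deriv (by simp)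
  have hcont : Continuous φ := hdiff.continuous
  have hHc := D.cont
  set U := Umap μ with hUdef
  have hm : Monotone U := Umap_mono μ
  have sys : Sys U φ (deriv φ) (fun p => C₁ * H (c * p)) D₀ :=
    { mono := hm
      tan := convex_tangent hdiff hconv
      mφ := hcont.measurable
      mg := hdc.measurable
      mS := by fun_prop
      nn := fun p => mul_nonneg (by linarith) (D.nn _)
      zero := by simp [D.zero]
      even := fun p => by simp only [mul_neg, D.symm]
      hD := hD1
      hW := fun x y hxy => by
        rcases hxy.eq_or_lt with rfl | hlt
        · simp only [sub_self, add_zero, mul_one]; linarith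
        · have h1 := delta_young D hb hU (a := 1) zero_le_one hlt
          have h2 : (1 / b) * (H 1 + t₀ ^ 2 + (y - x)) ≤
              (1 / b) * ((1 + H 1 + t₀ ^ 2) * (1 + (y - x))) := by
            gcongr
            nlinarith
          have h3 : (1 / b) * (1 + H 1 + t₀ ^ 2) * (1 + (y - x)) ≤ D₀ * (1 + (y - x)) := by
            apply mul_le_mul_of_nonneg_right _ (by linarith)
            linarith
          linarith
      small := fun p hp hs => by
        rcases D.lower (c * p) with h | h
        · have h1 : (2 * D₀ * p) ^ 2 ≤ (c * p) ^ 2 / 4 := by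
            have : 2 * D₀ * p ≤ c * p / 2 := by nlinarith
            have h0 : 0 ≤ 2 * D₀ * p := by positivity
            calc (2 * D₀ * p) ^ 2 ≤ (c * p / 2) ^ 2 := by gcongr
              _ = _ := by ring
          have h2 : H (c * p) ≤ C₁ * H (c * p) := le_mul_of_one_le_left (D.nn _) hC1'
          linarith
        · have h0 : 0 ≤ 2 * D₀ * p := by positivity
          have h1 : C₁ * t₀ ^ 2 ≤ C₁ * H (c * p) := by gcongr
          nlinarith
      big := fun p hp hs => by
        have := hlow p hp hs
        nlinarith
      h3 := fun p hp hs x y hxy => by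
        have h0 := hlow p hp hs
        have h1 := delta_young D hb hU (a := 2 * p / b) (by positivity) hxy
        have h2 : p * (U y - U x) = (b / 2) * (2 * p / b * (U y - U x)) := by field_simp
        have h3 : p * (U y - U x) ≤ (H (2 * p / b) + t₀ ^ 2 + (y - x)) / 2 := by
          rw [h2]
          calc _ ≤ (b / 2) * ((1 / b) * (H (2 * p / b) + t₀ ^ 2 + (y - x))) := by gcongr
            _ = _ := by field_simp
        have h4 : H (2 * p / b) ≤ H (c * p) := by
          apply D.mono (by positivity)
          calc 2 * p / b = 2 / b * p := by ring
            _ ≤ c * p := by gcongr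
        have h5 : (1 + t₀ ^ 2) * H (c * p) ≤ C₁ * H (c * p) := by
          apply mul_le_mul_of_nonneg_right hC1 (D.nn _)
        nlinarith [sq_nonneg t₀] }
  have key := sys.two_sided
  set a := φ (U 0) with ha
  have hconvt : ∀ F : ℝ → ℝ, Measurable F → (∀ y, 0 ≤ F y) →
      ∫⁻ y, ENNReal.ofReal (F y) ∂μ = ENNReal.ofReal (1 / 2) *
        ((∫⁻ x in Ioi (0:ℝ), ENNReal.ofReal (F (U x) * Real.exp (-x))) +
          ∫⁻ x in Ioi (0:ℝ), ENNReal.ofReal (F (U (-x)) * Real.exp (-x))) := by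
    intro F hF hF0
    rw [lintegral_Umap μ _ hF.ennreal_ofReal, mul_add,
      ← lintegral_const_mul' _ _ ENNReal.ofReal_ne_top,
      ← lintegral_const_mul' _ _ ENNReal.ofReal_ne_top]
    congr 1
    · congr 1; ext x
      rw [← ENNReal.ofReal_mul (by positivity), ← ENNReal.ofReal_mul (by positivity)]
      congr 1; ring
    · congr 1; ext x
      rw [← ENNReal.ofReal_mul (by positivity), ← ENNReal.ofReal_mul (by positivity)]
      congr 1; ring
  have hmain : ∫⁻ y, ENNReal.ofReal (psiE (φ y - a)) ∂μ ≤ ENNReal.ofReal (CH + 32) *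
      ∫⁻ y, ENNReal.ofReal (C₁ * H (c * deriv φ y) * Real.exp (φ y - a)) ∂μ := by
    rw [hconvt (fun y => psiE (φ y - a)) (by unfold psiE; fun_prop) (fun y => psiE_nonneg _),
      hconvt (fun y => C₁ * H (c * deriv φ y) * Real.exp (φ y - a)) (by fun_prop)
        (fun y => mul_nonneg (mul_nonneg (by linarith) (D.nn _)) (Real.exp_pos _).le),
      mul_left_comm]
    exact mul_le_mul' le_rfl key
  refine (Ent_exp_le hexp hK a).trans ((mul_le_mul' le_rfl hmain).trans ?_)
  rw [← mul_assoc, ← ENNReal.ofReal_mul (by positivity),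
    ← lintegral_const_mul' _ _ ENNReal.ofReal_ne_top]
  refine lintegral_mono fun y => ?_
  rw [← ENNReal.ofReal_mul (by positivity)]
  apply ENNReal.ofReal_le_ofReal
  have e1 : Real.exp (φ y) = Real.exp a * Real.exp (φ y - a) := by rw [← Real.exp_add]; ring_nf
  have e2 := D.mul_le hC21 (c * deriv φ y)
  calc Real.exp a * (CH + 32) * (C₁ * H (c * deriv φ y) * Real.exp (φ y - a))
      = C₂ * H (c * deriv φ y) * Real.exp (φ y) := by rw [e1, hC₂]; ring
    _ ≤ H (C₂ * (c * deriv φ y)) * Real.exp (φ y) := by gcongr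
    _ = _ := by rw [mul_assoc C₂]

end Backward

section Cutoff

/-- A smooth convex approximation of the positive part. -/
noncomputable def wz (y : ℝ) : ℝ := ∫ t in (0:ℝ)..y, Real.smoothTransition t

lemma wz_hasDerivAt (y : ℝ) : HasDerivAt wz (Real.smoothTransition y) y :=
  intervalIntegral.integral_hasDerivAt_right
    (Real.smoothTransition.continuous.intervalIntegrable _ _)
    (Real.smoothTransition.continuous.stronglyMeasurableAtFilter _ _)
    Real.smoothTransition.continuousAt

lemma wz_diff : Differentiable ℝ wz := fun y => (wz_hasDerivAt y).differentiableAt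

lemma wz_deriv : deriv wz = Real.smoothTransition := by
  ext y; exact (wz_hasDerivAt y).deriv

lemma wz_contDiff : ContDiff ℝ (⊤ : ℕ∞) wz := by
  rw [contDiff_infty_iff_deriv]
  exact ⟨wz_diff, by rw [wz_deriv]; exact Real.smoothTransition.contDiff⟩

lemma wz_convex : ConvexOn ℝ univ wz :=
  Monotone.convexOn_univ_of_deriv wz_diff (by rw [wz_deriv]; exact Real.smoothTransition.monotone)

lemma wz_mono : Monotone wz :=
  monotone_of_deriv_nonneg wz_diff fun y => by
    rw [wz_deriv]; exact Real.smoothTransition.nonneg y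

lemma wz_lip : LipschitzWith 1 wz :=
  lipschitzWith_of_nnnorm_deriv_le wz_diff fun y => by
    rw [wz_deriv]
    rw [← NNReal.coe_le_coe, coe_nnnorm, Real.norm_of_nonneg (Real.smoothTransition.nonneg y)]
    exact Real.smoothTransition.le_one y

lemma wz_zero : wz 0 = 0 := by simp [wz]

lemma wz_of_nonpos {y : ℝ} (hy : y ≤ 0) : wz y = 0 := by
  unfold wz
  rw [intervalIntegral.integral_symm, neg_eq_zero]
  apply intervalIntegral.integral_zero_ae
  refine Eventually.of_forall fun t ht => ?_
  rw [uIoc_of_le hy] at ht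
  exact Real.smoothTransition.zero_of_nonpos ht.2

lemma wz_nonneg (y : ℝ) : 0 ≤ wz y := by
  rcases le_total y 0 with h | h
  · rw [wz_of_nonpos h]
  · rw [← wz_zero]; exact wz_mono h

lemma wz_ge (y : ℝ) : y - 1 ≤ wz y := by
  rcases le_total y 1 with h | h
  · linarith [wz_nonneg y]
  · have h1 : (1:ℝ) * (y - 1) ≤ wz y - wz 1 :=
      (convex_Icc (1:ℝ) y).mul_sub_le_image_sub_of_le_deriv wz_diff.continuous.continuousOn
        wz_diff.differentiableOn (fun x hx => by
          rw [interior_Icc] at hx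
          rw [wz_deriv, Real.smoothTransition.one_of_one_le hx.1.le]) 1 ⟨le_rfl, h⟩ y ⟨h, le_rfl⟩ h
    linarith [wz_nonneg 1]

end Cutoff

section ODE

lemma ode_a {K K' : ℝ → ℝ} {l L A α h : ℝ} (hl : 0 < l) (hlL : l ≤ L) (hα : 1 < α)
    (hA : 0 ≤ A) (hh : 0 ≤ h)
    (hK : ∀ s, l ≤ s → HasDerivAt K (K' s) s)
    (hle : ∀ s, l ≤ s → s ≤ L → s * K' s - K s ≤ A * (s / L) ^ α * h) :
    K L ≤ L / l * K l + A / (α - 1) * h := by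
  have hL : 0 < L := hl.trans_le hlL
  have hα' : 0 < α - 1 := by linarith
  set B := A * h / (L ^ α * (α - 1)) with hB
  have hLα : 0 < L ^ α := Real.rpow_pos_of_pos hL α
  have hB0 : 0 ≤ B := by positivity
  have hder : ∀ s, l ≤ s → HasDerivAt (fun s => K s / s - B * s ^ (α - 1))
      ((K' s * s - K s * 1) / s ^ 2 - B * ((α - 1) * s ^ (α - 1 - 1))) s := by
    intro s hs
    have hs0 : s ≠ 0 := by linarith
    exact ((hK s hs).div (hasDerivAt_id s) hs0).sub
      ((Real.hasDerivAt_rpow_const (Or.inl hs0)).const_mul B)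
  have hanti : AntitoneOn (fun s => K s / s - B * s ^ (α - 1)) (Icc l L) := by
    apply antitoneOn_of_deriv_nonpos (convex_Icc l L)
    · exact fun s hs => (hder s hs.1).continuousAt.continuousWithinAt
    · rw [interior_Icc]
      exact fun s hs => (hder s hs.1.le).differentiableAt.differentiableWithinAt
    · rw [interior_Icc]
      intro s hs
      rw [(hder s hs.1.le).deriv]
      have hs0 : 0 < s := hl.trans hs.1
      have h1 := hle s hs.1.le hs.2.le
      have h2 : s ^ (α - 1 - 1) = s ^ α / s ^ 2 := by
        rw [Real.rpow_sub_one hs0.ne', Real.rpow_sub_one hs0.ne']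
        field_simp
      rw [Real.div_rpow hs0.le hL.le] at h1
      have h3 : B * ((α - 1) * s ^ (α - 1 - 1)) = (A * (s ^ α / L ^ α) * h) / s ^ 2 := by
        rw [h2, hB]; field_simp
      rw [h3, ← sub_div]
      apply div_nonpos_of_nonpos_of_nonneg _ (by positivity)
      linarith
  have h1 := hanti ⟨le_rfl, hlL⟩ ⟨hlL, le_rfl⟩ hlL
  simp only at h1
  have h2 : 0 ≤ B * l ^ (α - 1) := by positivity
  have h3 : K L / L ≤ K l / l + B * L ^ (α - 1) := by linarith
  have h4 : K L = L * (K L / L) := by field_simp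
  rw [h4]
  calc L * (K L / L) ≤ L * (K l / l + B * L ^ (α - 1)) := by gcongr
    _ = L / l * K l + A / (α - 1) * h := by
      rw [Real.rpow_sub_one hL.ne', hB]; field_simp

lemma ode_b {K K' : ℝ → ℝ} {l L p h : ℝ} (hl : 0 < l) (hlL : l ≤ L)
    (hp : 0 ≤ p) (hh : 0 ≤ h) (hK0 : ∀ s, l ≤ s → 0 ≤ K s)
    (hK : ∀ s, l ≤ s → HasDerivAt K (K' s) s)
    (hle : ∀ s, l ≤ s → s ≤ L → s * K' s - K s ≤ (s / L * h) * (K s + p)) :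
    K L + p ≤ L / l * (K l + p) * Real.exp h := by
  have hL : 0 < L := hl.trans_le hlL
  set e := h / L with he
  have hder : ∀ s, l ≤ s → HasDerivAt (fun s => (K s + p) / s * Real.exp (-(e * s)))
      ((K' s * s - (K s + p) * 1) / s ^ 2 * Real.exp (-(e * s)) +
        (K s + p) / s * (Real.exp (-(e * s)) * (-(e * 1)))) s := by
    intro s hs
    have hs0 : s ≠ 0 := by linarith
    exact (((hK s hs).add_const p).div (hasDerivAt_id s) hs0).mul
      (((hasDerivAt_id s).const_mul e).neg.exp)
  have hanti : AntitoneOn (fun s => (K s + p) / s * Real.exp (-(e * s))) (Icc l L) := by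
    apply antitoneOn_of_deriv_nonpos (convex_Icc l L)
    · exact fun s hs => (hder s hs.1).continuousAt.continuousWithinAt
    · rw [interior_Icc]
      exact fun s hs => (hder s hs.1.le).differentiableAt.differentiableWithinAt
    · rw [interior_Icc]
      intro s hs
      rw [(hder s hs.1.le).deriv]
      have hs0 : 0 < s := hl.trans hs.1
      have h1 := hle s hs.1.le hs.2.le
      have h3 : (K' s * s - (K s + p) * 1) / s ^ 2 * Real.exp (-(e * s)) +
        (K s + p) / s * (Real.exp (-(e * s)) * (-(e * 1))) =
        ((s * K' s - K s) - (s / L * h) * (K s + p) - p) / s ^ 2 * Real.exp (-(e * s)) := by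
        rw [he]; field_simp; ring
      rw [h3]
      apply mul_nonpos_of_nonpos_of_nonneg _ (Real.exp_pos _).le
      apply div_nonpos_of_nonpos_of_nonneg _ (by positivity)
      linarith
  have h1 := hanti ⟨le_rfl, hlL⟩ ⟨hlL, le_rfl⟩ hlL
  simp only at h1
  have h2 : Real.exp (-(e * l)) ≤ 1 := Real.exp_le_one_iff.2 (by
    have : 0 ≤ e * l := by positivity
    linarith)
  have hKl := hK0 l le_rfl
  have h3 : (K l + p) / l * Real.exp (-(e * l)) ≤ (K l + p) / l :=
    mul_le_of_le_one_right (by positivity) h2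
  have h5 : e * L = h := by rw [he]; field_simp
  rw [h5] at h1
  have h6 : K L + p = L * Real.exp h * ((K L + p) / L * Real.exp (-h)) := by
    rw [Real.exp_neg]; field_simp
  rw [h6]
  calc _ ≤ L * Real.exp h * ((K l + p) / l) := by gcongr; linarith
    _ = _ := by ring

end ODE

section Tail

variable {H Hstar : ℝ → ℝ} {t₀ A α : ℝ}

/-- The convex log-Sobolev inequality with constant `c`. -/
def LSI (H : ℝ → ℝ) (μ : Measure ℝ) (c : ℝ) : Prop :=
  ∀ φ : ℝ → ℝ, ContDiff ℝ (⊤ : ℕ∞) φ → ConvexOn ℝ Set.univ φ →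
    (∃ K : ℝ≥0, LipschitzWith K φ) →
    Ent μ (fun x => Real.exp (φ x)) ≤
      ∫⁻ x, ENNReal.ofReal (H (c * deriv φ x) * Real.exp (φ x)) ∂μ

lemma wa_lip (a : ℝ) : LipschitzWith 1 (fun y => wz (y - a)) := by
  have := wz_lip.comp (LipschitzWith.id.sub (LipschitzWith.const a))
  simpa [Function.comp_def] using this

lemma wa_smul_lip (a l : ℝ) : ∃ K : ℝ≥0, LipschitzWith K (fun y => l * wz (y - a)) := by
  refine ⟨‖l‖₊, LipschitzWith.of_dist_le_mul fun x y => ?_⟩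
  have := (wa_lip a).dist_le_mul x y
  rw [Real.dist_eq, ← mul_sub, abs_mul, ← Real.dist_eq]
  simp only [NNReal.coe_one, one_mul] at this
  rw [coe_nnnorm, Real.norm_eq_abs]
  gcongr

lemma wa_hasDerivAt (a l y : ℝ) :
    HasDerivAt (fun y => l * wz (y - a)) (l * Real.smoothTransition (y - a)) y :=
  ((wz_hasDerivAt (y - a)).comp_sub_const y a).const_mul l

lemma ls_real (D : HData H Hstar t₀ A α) {μ : Measure ℝ} [IsProbabilityMeasure μ]
    (hexp : ∀ s > (0:ℝ), Integrable (fun x => Real.exp (s * |x|)) μ)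
    {c : ℝ} (hc : 0 < c) (hLS : LSI H μ c) (a : ℝ) {l : ℝ} (hl : 0 ≤ l) :
    (∫ y, Real.exp (l * wz (y - a)) * (l * wz (y - a)) ∂μ) -
      (∫ y, Real.exp (l * wz (y - a)) ∂μ) * Real.log (∫ y, Real.exp (l * wz (y - a)) ∂μ) ≤
    H (c * l) * ∫ y in Ioi a, Real.exp (l * wz (y - a)) ∂μ := by
  obtain ⟨K, hK⟩ := wa_smul_lip a l
  obtain ⟨i1, i2⟩ := lip_integrable hexp hK
  have hcd : ContDiff ℝ (⊤ : ℕ∞) (fun y => l * wz (y - a)) :=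
    contDiff_const.mul (wz_contDiff.comp (contDiff_id.sub contDiff_const))
  have hcv : ConvexOn ℝ univ (fun y => l * wz (y - a)) := by
    apply Monotone.convexOn_univ_of_deriv
    · exact fun y => (wa_hasDerivAt a l y).differentiableAt
    · intro x y hxy
      rw [(wa_hasDerivAt a l x).deriv, (wa_hasDerivAt a l y).deriv]
      exact mul_le_mul_of_nonneg_left (Real.smoothTransition.monotone (by linarith)) hl
  have h := hLS _ hcd hcv ⟨K, hK⟩
  unfold Ent at h
  have i2' : Integrable (fun x => Real.exp (l * wz (x - a)) *
      Real.log (Real.exp (l * wz (x - a)))) μ := by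
    simpa only [Real.log_exp] using i2
  rw [if_pos i2'] at h
  simp only [Real.log_exp] at h
  have hM : 0 ≤ ∫ y in Ioi a, Real.exp (l * wz (y - a)) ∂μ :=
    integral_nonneg fun y => (Real.exp_pos _).le
  have hR : ∫⁻ x, ENNReal.ofReal (H (c * deriv (fun y => l * wz (y - a)) x) *
      Real.exp (l * wz (x - a))) ∂μ ≤
      ENNReal.ofReal (H (c * l) * ∫ y in Ioi a, Real.exp (l * wz (y - a)) ∂μ) := by
    rw [ENNReal.ofReal_mul (D.nn _), ofReal_integral_eq_lintegral_ofReal i1.integrableOn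
      (Eventually.of_forall fun y => (Real.exp_pos _).le),
      ← lintegral_const_mul' _ _ ENNReal.ofReal_ne_top, ← lintegral_indicator measurableSet_Ioi]
    refine lintegral_mono fun x => ?_
    rw [(wa_hasDerivAt a l x).deriv]
    by_cases hx : x ∈ Ioi a
    · rw [indicator_of_mem hx, ← ENNReal.ofReal_mul (D.nn _)]
      apply ENNReal.ofReal_le_ofReal
      have h1 := Real.smoothTransition.nonneg (x - a)
      have h2 := Real.smoothTransition.le_one (x - a)
      have : H (c * (l * Real.smoothTransition (x - a))) ≤ H (c * l) := by
        apply D.mono (by positivity)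
        have : l * Real.smoothTransition (x - a) ≤ l := mul_le_of_le_one_right hl h2
        gcongr
      gcongr
    · have hx' : x ≤ a := not_lt.1 hx
      rw [indicator_of_notMem hx, Real.smoothTransition.zero_of_nonpos (by linarith)]
      simp [D.zero]
  have h3 := h.trans hR
  by_contra! hcon
  rw [ENNReal.ofReal_le_ofReal_iff (mul_nonneg (D.nn _) hM)] at h3
  linarith

lemma M_eq {μ : Measure ℝ} [IsProbabilityMeasure μ]
    (hexp : ∀ s > (0:ℝ), Integrable (fun x => Real.exp (s * |x|)) μ) (a l : ℝ) :
    ∫ y in Ioi a, Real.exp (l * wz (y - a)) ∂μ =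
      (∫ y, Real.exp (l * wz (y - a)) ∂μ) - 1 + μ.real (Ioi a) := by
  obtain ⟨K, hK⟩ := wa_smul_lip a l
  obtain ⟨i1, i2⟩ := lip_integrable hexp hK
  have h1 := integral_add_compl (measurableSet_Ioi (a := a)) i1
  have h2 : ∫ y in (Ioi a)ᶜ, Real.exp (l * wz (y - a)) ∂μ = ∫ y in (Ioi a)ᶜ, (1:ℝ) ∂μ := by
    refine setIntegral_congr_fun measurableSet_Ioi.compl fun y hy => ?_
    have hy' : y ≤ a := not_lt.1 hy
    simp [wz_of_nonpos (by linarith : y - a ≤ 0)]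
  rw [h2, setIntegral_const, measureReal_compl measurableSet_Ioi] at h1
  simp at h1
  linarith

lemma tail_bound (D : HData H Hstar t₀ A α) {μ : Measure ℝ} [IsProbabilityMeasure μ]
    (hexp : ∀ s > (0:ℝ), Integrable (fun x => Real.exp (s * |x|)) μ)
    {c : ℝ} (hc : 0 < c) (hLS : LSI H μ c) (a₀ : ℝ) :
    ∃ l > 0, ∀ L, l ≤ L → ∀ a, a₀ ≤ a → ∀ r > 0,
      μ.real (Ici (a + r)) * Real.exp (L * (r - 1)) ≤
        μ.real (Ioi a) * Real.exp (2 + 2 * (L / l) + (1 + A / (α - 1)) * H (c * L)) := by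
  have hInte : ∀ a t, Integrable (fun y => Real.exp (t * wz (y - a))) μ := by
    intro a t
    obtain ⟨K, hK⟩ := wa_smul_lip a t
    exact (lip_integrable hexp hK).1
  have hint2 : ∀ a t, Integrable (fun y => Real.exp (t * wz (y - a)) * (t * wz (y - a))) μ := by
    intro a t
    obtain ⟨K, hK⟩ := wa_smul_lip a t
    exact (lip_integrable hexp hK).2
  -- choice of `l`
  obtain ⟨l, hl0, hlH, hlN⟩ : ∃ l > 0, H (c * l) ≤ 1 / 4 ∧
      ∫ y, Real.exp (l * wz (y - a₀)) ∂μ ≤ 1 + 1 / 4 := by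
    have c1 : Tendsto (fun l => H (c * l)) (𝓝 0) (𝓝 0) := by
      have : Continuous fun l => H (c * l) := D.cont.comp (continuous_const.mul continuous_id)
      have h := this.tendsto 0
      simpa [D.zero] using h
    have c2 : Tendsto (mgf (fun y => wz (y - a₀)) μ) (𝓝 0) (𝓝 1) := by
      have h := (continuous_mgf (X := fun y => wz (y - a₀)) (μ := μ) (hInte a₀)).tendsto 0
      simpa using h
    have e1 := (c1.eventually (gt_mem_nhds (by norm_num : (0:ℝ) < 1/4))).filter_mono
      (nhdsWithin_le_nhds (s := Ioi 0))
    have e2 := (c2.eventually (gt_mem_nhds (by norm_num : (1:ℝ) < 1 + 1/4))).filter_mono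
      (nhdsWithin_le_nhds (s := Ioi 0))
    obtain ⟨l, ⟨h1, h2⟩, h3⟩ := ((e1.and e2).and self_mem_nhdsWithin).exists
    exact ⟨l, h3, h1.le, h2.le⟩
  refine ⟨l, hl0, fun L hL a ha r hr => ?_⟩
  have hL0 : 0 < L := hl0.trans_le hL
  set p := μ.real (Ioi a) with hp
  have hp0 : 0 ≤ p := measureReal_nonneg
  have hp1 : p ≤ 1 := measureReal_le_one
  set Z : ℝ → ℝ := fun t => ∫ y, Real.exp (t * wz (y - a)) ∂μ with hZ
  set M : ℝ → ℝ := fun t => ∫ y in Ioi a, Real.exp (t * wz (y - a)) ∂μ with hM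
  have hMZ : ∀ t, M t = Z t - 1 + p := fun t => M_eq hexp a t
  have hZ1 : ∀ t, 0 ≤ t → 1 ≤ Z t := by
    intro t ht
    have : ∫ y, (1:ℝ) ∂μ ≤ Z t :=
      integral_mono (integrable_const _) (hInte a t) fun y =>
        Real.one_le_exp (mul_nonneg ht (wz_nonneg _))
    simpa using this
  have hls : ∀ t, 0 ≤ t →
      (∫ y, Real.exp (t * wz (y - a)) * (t * wz (y - a)) ∂μ) - Z t * Real.log (Z t) ≤
      H (c * t) * M t := fun t ht => ls_real D hexp hc hLS a ht
  -- initial estimate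
  have hinit : M l ≤ 2 * Real.exp 1 * p := by
    have hN : Z l ≤ 1 + 1 / 4 := by
      refine le_trans (integral_mono (hInte a l) (hInte a₀ l) fun y => ?_) hlN
      apply Real.exp_le_exp.2
      apply mul_le_mul_of_nonneg_left (wz_mono (by linarith)) hl0.le
    have h1 := hls l hl0.le
    have h2 : 2 * M l - Real.exp 1 * p ≤
        ∫ y, Real.exp (l * wz (y - a)) * (l * wz (y - a)) ∂μ := by
      have e1 : 2 * M l - Real.exp 1 * p =
          ∫ y in Ioi a, (2 * Real.exp (l * wz (y - a)) - Real.exp 1) ∂μ := by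
        rw [integral_sub ((hInte a l).integrableOn.const_mul 2) (integrable_const _),
          integral_const_mul, setIntegral_const]
        rw [smul_eq_mul]; ring
      rw [e1]
      refine le_trans (integral_mono (((hInte a l).integrableOn.const_mul 2).sub
        (integrable_const _)) (hint2 a l).integrableOn fun y => ?_)
        (setIntegral_le_integral (hint2 a l) (Eventually.of_forall fun y => ?_))
      · set u := l * wz (y - a)
        have q1 := Real.add_one_le_exp (1 - u)
        have q2 : Real.exp 1 = Real.exp u * Real.exp (1 - u) := by
          rw [← Real.exp_add]; ring_nf
        have q3 := Real.exp_pos u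
        simp only [Pi.sub_apply]
        rw [q2]
        nlinarith
      · exact mul_nonneg (Real.exp_pos _).le (mul_nonneg hl0.le (wz_nonneg _))
    have hz1 := hZ1 l hl0.le
    have h3 : Real.log (Z l) ≤ Z l - 1 := Real.log_le_sub_one_of_pos (by linarith)
    have h4 := hMZ l
    have hM0 : 0 ≤ M l := by linarith
    have h5 : H (c * l) * M l ≤ 1 / 4 * M l := by gcongr
    have h6 : Z l * Real.log (Z l) ≤ Z l * (Z l - 1) := by gcongr
    have h7 : Z l * (Z l - 1) ≤ (1 + 1/4) * M l := by
      have : Z l - 1 ≤ M l := by linarith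
      apply mul_le_mul hN this (by linarith) (by norm_num)
    linarith
  -- the differential inequality
  set K : ℝ → ℝ := fun t => Real.log (Z t) with hKdef
  set K' : ℝ → ℝ := fun t => (∫ y, wz (y - a) * Real.exp (t * wz (y - a)) ∂μ) / Z t with hK'def
  have hder : ∀ s, l ≤ s → HasDerivAt K (K' s) s := by
    intro s hs
    have hset : integrableExpSet (fun y => wz (y - a)) μ = univ :=
      eq_univ_of_forall fun t => hInte a t
    have h1 : HasDerivAt (mgf (fun y => wz (y - a)) μ) _ s :=
      hasDerivAt_mgf (by rw [hset, interior_univ]; trivial)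
    have hz := hZ1 s (by linarith)
    exact h1.log (by
      have : mgf (fun y => wz (y - a)) μ s = Z s := rfl
      rw [this]; linarith)
  have hK0 : ∀ s, l ≤ s → 0 ≤ K s := fun s hs => Real.log_nonneg (hZ1 s (by linarith))
  have hMK : ∀ s, 0 ≤ s → M s ≤ Z s ∧ M s ≤ Z s * (K s + p) := by
    intro s hs
    have hz := hZ1 s hs
    rw [hMZ s]
    refine ⟨by linarith, ?_⟩
    have h1 : 1 - (Z s)⁻¹ ≤ K s := Real.one_sub_inv_le_log_of_pos (by linarith)
    have h2 : Z s * (1 - (Z s)⁻¹) ≤ Z s * K s := by gcongr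
    rw [mul_sub, mul_inv_cancel₀ (by linarith)] at h2
    nlinarith
  have hdi : ∀ s, l ≤ s → s * K' s - K s ≤ H (c * s) * (M s / Z s) := by
    intro s hs
    have hz : 0 < Z s := by linarith [hZ1 s (by linarith)]
    have h1 := hls s (by linarith)
    have h2 : ∫ y, Real.exp (s * wz (y - a)) * (s * wz (y - a)) ∂μ =
        s * ∫ y, wz (y - a) * Real.exp (s * wz (y - a)) ∂μ := by
      rw [← integral_const_mul]
      congr 1; ext y; ring
    rw [h2] at h1
    have h3 : s * K' s - K s =
        (s * (∫ y, wz (y - a) * Real.exp (s * wz (y - a)) ∂μ) - Z s * Real.log (Z s)) / Z s := by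
      simp only [hK'def, hKdef]; field_simp
    rw [h3, ← mul_div_assoc]
    gcongr
  have hHL := D.nn (c * L)
  have ha1 := ode_a (K := K) (K' := K') (h := H (c * L)) (A := A) hl0 hL D.hα₁
    (by linarith [D.hA]) hHL hder (by
      intro s hs hsL
      have hs0 : 0 < s := hl0.trans_le hs
      have hz : 0 < Z s := by linarith [hZ1 s hs0.le]
      refine (hdi s hs).trans ?_
      have h1 : M s / Z s ≤ 1 := (div_le_one hz).2 (hMK s hs0.le).1
      have h2 := D.scale (c * L) (s / L) ⟨by positivity, (div_le_one hL0).2 hsL⟩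
      have h3 : s / L * (c * L) = c * s := by field_simp
      rw [h3] at h2
      refine le_trans ?_ h2
      exact mul_le_of_le_one_right (D.nn _) h1)
  have hb1 := ode_b (K := K) (K' := K') (h := H (c * L)) (p := p) hl0 hL hp0 hHL hK0 hder (by
      intro s hs hsL
      have hs0 : 0 < s := hl0.trans_le hs
      have hz : 0 < Z s := by linarith [hZ1 s hs0.le]
      refine (hdi s hs).trans ?_
      have h1 : M s / Z s ≤ K s + p := by
        rw [div_le_iff₀ hz]; linarith [(hMK s hs0.le).2]
      have h2 := D.sub_scale (s := s / L) (by positivity) ((div_le_one hL0).2 hsL) (c * L)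
      have h3 : s / L * (c * L) = c * s := by field_simp
      rw [h3] at h2
      have h4 := hK0 s hs
      have h5 := D.nn (c * s)
      calc H (c * s) * (M s / Z s) ≤ H (c * s) * (K s + p) := by gcongr
        _ ≤ _ := by gcongr)
  have hKl : K l + p ≤ 2 * Real.exp 1 * p := by
    have : K l ≤ Z l - 1 := Real.log_le_sub_one_of_pos (by linarith [hZ1 l hl0.le])
    have := hMZ l
    linarith
  have hKl' : K l ≤ 1 := by
    have h1 : K l ≤ Z l - 1 := Real.log_le_sub_one_of_pos (by linarith [hZ1 l hl0.le])
    have hN : Z l ≤ 1 + 1 / 4 := by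
      refine le_trans (integral_mono (hInte a l) (hInte a₀ l) fun y => ?_) hlN
      apply Real.exp_le_exp.2
      apply mul_le_mul_of_nonneg_left (wz_mono (by linarith)) hl0.le
    linarith
  -- conclusion
  have hx0 : 0 < L / l := by positivity
  have hML : M L ≤ p * Real.exp (2 + 2 * (L / l) + (1 + A / (α - 1)) * H (c * L)) := by
    have hz : 0 < Z L := by linarith [hZ1 L hL0.le]
    have e1 : Z L = Real.exp (K L) := (Real.exp_log hz).symm
    have h1 := (hMK L hL0.le).2
    have hKL : K L ≤ L / l + A / (α - 1) * H (c * L) := by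
      have : L / l * K l ≤ L / l * 1 := by gcongr
      linarith
    have e2 : Z L ≤ Real.exp (L / l + A / (α - 1) * H (c * L)) := by
      rw [e1]; exact Real.exp_le_exp.2 hKL
    have e3 : K L + p ≤ Real.exp (L / l) * (Real.exp 2 * p) * Real.exp (H (c * L)) := by
      refine hb1.trans ?_
      have q1 : L / l ≤ Real.exp (L / l) := by linarith [Real.add_one_le_exp (L / l)]
      have q2 : 2 * Real.exp 1 ≤ Real.exp 2 := by
        have : Real.exp 2 = Real.exp 1 * Real.exp 1 := by rw [← Real.exp_add]; norm_num
        rw [this]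
        have := Real.add_one_le_exp (1:ℝ)
        nlinarith
      have q3 : K l + p ≤ Real.exp 2 * p := hKl.trans (by gcongr)
      have q4 := hK0 l le_rfl
      gcongr
    have hKLp : 0 ≤ K L + p := by linarith [hK0 L hL]
    calc M L ≤ Z L * (K L + p) := h1
      _ ≤ Real.exp (L / l + A / (α - 1) * H (c * L)) *
          (Real.exp (L / l) * (Real.exp 2 * p) * Real.exp (H (c * L))) := by gcongr
      _ = p * (Real.exp (L / l + A / (α - 1) * H (c * L)) * Real.exp (L / l) * Real.exp 2 *
          Real.exp (H (c * L))) := by ring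
      _ = _ := by
          rw [← Real.exp_add, ← Real.exp_add, ← Real.exp_add]
          congr 2; ring
  refine le_trans ?_ hML
  have hsub : Ici (a + r) ⊆ Ioi a := fun y hy => by
    have := mem_Ici.1 hy
    exact mem_Ioi.2 (by linarith)
  calc μ.real (Ici (a + r)) * Real.exp (L * (r - 1))
      = ∫ y in Ici (a + r), Real.exp (L * (r - 1)) ∂μ := by rw [setIntegral_const, smul_eq_mul]
    _ ≤ ∫ y in Ici (a + r), Real.exp (L * wz (y - a)) ∂μ := by
        refine setIntegral_mono_on (integrable_const _) (hInte a L).integrableOn measurableSet_Ici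
          fun y hy => ?_
        apply Real.exp_le_exp.2
        have := wz_ge (y - a)
        have h2 := mem_Ici.1 hy
        apply mul_le_mul_of_nonneg_left _ hL0.le
        linarith
    _ ≤ M L := setIntegral_mono_set (hInte a L).integrableOn
        (Eventually.of_forall fun y => (Real.exp_pos _).le) hsub.eventuallyLE

end Tail

section Forward

variable {H Hstar : ℝ → ℝ} {t₀ A α : ℝ}

lemma growth (D : HData H Hstar t₀ A α) {μ : Measure ℝ} [IsProbabilityMeasure μ]
    (hexp : ∀ s > (0:ℝ), Integrable (fun x => Real.exp (s * |x|)) μ)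
    {c : ℝ} (hc : 0 < c) (hLS : LSI H μ c) (a₀ : ℝ) :
    ∃ E > (0:ℝ), ∀ a, a₀ ≤ a → ∀ r, 0 ≤ r → ∀ h > (0:ℝ), ∀ P > (0:ℝ),
      μ.real (Ioi a) ≤ P → P * Real.exp (-h) ≤ μ.real (Ici (a + r)) →
      r ≤ E * cinv Hstar (t₀ ^ 2 + h) := by
  obtain ⟨l, hl, hT⟩ := tail_bound D hexp hc hLS a₀
  have hα := D.hα₁
  have hA := D.hA
  have ht₀ := D.ht₀
  have hs1 := D.star_nonneg 1
  obtain ⟨A', hA'⟩ : ∃ A', A' = A / (α - 1) := ⟨_, rfl⟩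
  have hA'0 : 0 ≤ A' := by rw [hA']; exact div_nonneg (by linarith) (by linarith)
  obtain ⟨B, hB⟩ : ∃ B, B = (1 + 2 / l) / c := ⟨_, rfl⟩
  have hB0 : 0 ≤ B := by rw [hB]; positivity
  obtain ⟨C₃, hC₃⟩ : ∃ C₃, C₃ = 1 + A' + B := ⟨_, rfl⟩
  have hC₃1 : 1 ≤ C₃ := by linarith
  have hC₃0 : 0 < C₃ := by linarith
  obtain ⟨C₁, hC₁⟩ : ∃ C₁, C₁ = 2 + B * Hstar 1 + C₃ * H (c * l) := ⟨_, rfl⟩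
  have hHl := D.nn (c * l)
  have hC₁0 : 0 < C₁ := by rw [hC₁]; positivity
  obtain ⟨κ, hκ⟩ : ∃ κ, κ = t₀ ^ 2 / (2 * (t₀ ^ 2 + C₁)) := ⟨_, rfl⟩
  have hκ0 : 0 < κ := by rw [hκ]; positivity
  have hκe : κ * (2 * (t₀ ^ 2 + C₁)) = t₀ ^ 2 := by rw [hκ]; field_simp
  have ht2 : 0 < t₀ ^ 2 := by positivity
  have hκ1 : κ ≤ 1 := by
    rw [hκ, div_le_one (by positivity)]; nlinarith
  have hκC : κ * C₁ < t₀ ^ 2 := by nlinarith [mul_pos hκ0 hC₁0, mul_pos hκ0 ht2]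
  refine ⟨C₃ * c / κ, by positivity, ?_⟩
  intro a ha r hr h hh P hP hPa hPr
  rcases hr.eq_or_lt with rfl | hr0
  · have := HData.cinv_nonneg (Hstar := Hstar) (t₀ ^ 2 + h)
    positivity
  have key1 : ∀ L, l ≤ L → L * r ≤ h + 2 + B * Hstar 1 + C₃ * H (c * L) := by
    intro L hL
    have h1 := hT L hL a ha r hr0
    rw [← hA'] at h1
    have h2 : P * Real.exp (-h + L * (r - 1))
        ≤ P * Real.exp (2 + 2 * (L / l) + (1 + A') * H (c * L)) := by
      calc P * Real.exp (-h + L * (r - 1)) = P * Real.exp (-h) * Real.exp (L * (r - 1)) := by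
            rw [Real.exp_add]; ring
        _ ≤ μ.real (Ici (a + r)) * Real.exp (L * (r - 1)) := by gcongr
        _ ≤ _ := h1
        _ ≤ _ := by gcongr
    have h3 := Real.exp_le_exp.1 (le_of_mul_le_mul_left h2 hP)
    have h4 := D.young 1 (c * L)
    have h5 := mul_le_mul_of_nonneg_left h4 hB0
    have h6 : B * (1 * (c * L)) = L + 2 * (L / l) := by
      rw [hB]; field_simp
    rw [hC₃]
    nlinarith
  have key2 : ∀ L, 0 ≤ L → L * r ≤ h + C₁ + H (C₃ * (c * L)) := by
    intro L hL
    rcases le_total l L with hlL | hlL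
    · have h1 := key1 L hlL
      have h2 := D.mul_le hC₃1 (c * L)
      have h3 : 0 ≤ C₃ * H (c * l) := by positivity
      linarith
    · have h1 := key1 l le_rfl
      have h2 := D.nn (C₃ * (c * L))
      have h3 : L * r ≤ l * r := by gcongr
      linarith
  have key3 : Hstar (r / (C₃ * c)) ≤ h + C₁ := by
    refine D.star_le (by positivity) fun y hy => ?_
    have h1 := key2 (y / (C₃ * c)) (by positivity)
    have h2 : C₃ * (c * (y / (C₃ * c))) = y := by field_simp
    rw [h2] at h1
    have h3 : r / (C₃ * c) * y = y / (C₃ * c) * r := by ring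
    rw [h3]; linarith
  have key4 : Hstar (κ * (r / (C₃ * c))) < t₀ ^ 2 + h := by
    have h1 := D.star_scale hκ0.le hκ1 (r / (C₃ * c))
    have h2 := mul_le_mul_of_nonneg_left key3 hκ0.le
    have h3 : κ * h ≤ h := by nlinarith
    nlinarith
  have key5 := D.le_cinv key4
  calc r = C₃ * c / κ * (κ * (r / (C₃ * c))) := by field_simp
    _ ≤ _ := by gcongr

lemma neg_LSI (D : HData H Hstar t₀ A α) {μ : Measure ℝ} [IsProbabilityMeasure μ]
    {c : ℝ} (hLS : LSI H μ c) : LSI H (μ.map (fun x => -x)) c := by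
  intro φ hφ hconv hlip
  have he : MeasurableEmbedding (fun x : ℝ => -x) := (MeasurableEquiv.neg ℝ).measurableEmbedding
  obtain ⟨K, hK⟩ := hlip
  have h := hLS (fun x => φ (-x)) (hφ.comp contDiff_neg) (by
      refine ⟨convex_univ, fun x _ y _ a b ha hb hab => ?_⟩
      have := hconv.2 (mem_univ (-x)) (mem_univ (-y)) ha hb hab
      simp only [smul_eq_mul] at this ⊢
      convert this using 2
      ring) ⟨K, LipschitzWith.of_dist_le_mul fun x y => by
        have := hK.dist_le_mul (-x) (-y)
        rwa [dist_neg_neg] at this⟩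
  have e1 : Ent (μ.map (fun x => -x)) (fun x => Real.exp (φ x))
      = Ent μ (fun x => Real.exp (φ (-x))) := by
    unfold Ent
    rw [he.integrable_map_iff, he.integral_map, he.integral_map]
    rfl
  rw [e1, he.lintegral_map]
  refine h.trans (le_of_eq ?_)
  congr 1
  ext x
  rw [deriv_comp_neg, mul_neg, D.symm]

lemma forward (D : HData H Hstar t₀ A α) (μ : Measure ℝ) [IsProbabilityMeasure μ]
    (hexp : ∀ s > (0:ℝ), Integrable (fun x => Real.exp (s * |x|)) μ)
    {c : ℝ} (hc : 0 < c) (hLS : LSI H μ c) :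
    ∃ b > (0:ℝ), ∀ h > (0:ℝ), ∀ x : ℝ,
      Umap μ (x + h) - Umap μ x ≤ (1 / b) * cinv Hstar (t₀ ^ 2 + h) := by
  have he : MeasurableEmbedding (fun x : ℝ => -x) := (MeasurableEquiv.neg ℝ).measurableEmbedding
  haveI : IsProbabilityMeasure (μ.map (fun x => -x)) :=
    Measure.isProbabilityMeasure_map measurable_neg.aemeasurable
  obtain ⟨E₁, hE₁, h1⟩ := growth D hexp hc hLS (Umap μ 0)
  obtain ⟨E₂, hE₂, h2⟩ := growth D (μ := μ.map (fun x => -x)) (by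
    intro s hs
    rw [he.integrable_map_iff]
    simpa [Function.comp_def] using hexp s hs) hc (neg_LSI D hLS) (-Umap μ 0)
  have hUm := Umap_mono μ
  have hIoi : ∀ x, μ.real (Ioi (Umap μ x)) ≤ 1 - expCDF x := fun x => by
    have := le_cdf_invCDF μ (expCDF_lt_one x)
    rw [← compl_Iic, probReal_compl_eq_one_sub measurableSet_Iic]
    unfold Umap; linarith
  have hIci : ∀ x, 1 - expCDF x ≤ μ.real (Ici (Umap μ x)) := fun x => by
    have := real_Iio_invCDF_le μ (expCDF_pos x) (expCDF_lt_one x)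
    rw [← compl_Iio, probReal_compl_eq_one_sub measurableSet_Iio]
    unfold Umap; linarith
  have right : ∀ x y h, 0 ≤ x → x ≤ y → y ≤ x + h → 0 < h →
      Umap μ y - Umap μ x ≤ E₁ * cinv Hstar (t₀ ^ 2 + h) := by
    intro x y h hx hxy hyh hh
    refine h1 (Umap μ x) (hUm hx) _ (sub_nonneg.2 (hUm hxy)) h hh (Real.exp (-x) / 2)
      (by positivity) ?_ ?_
    · have := hIoi x
      rw [expCDF, if_neg (by linarith)] at this
      linarith
    · have := hIci y
      rw [expCDF, if_neg (by linarith)] at this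
      rw [add_sub_cancel]
      have e : Real.exp (-x) * Real.exp (-h) ≤ Real.exp (-y) := by
        rw [← Real.exp_add]; exact Real.exp_le_exp.2 (by linarith)
      linarith
  have hexpn : ∀ y, y ≤ 0 → expCDF y = Real.exp y / 2 := by
    intro y hy
    rcases hy.lt_or_eq with h | rfl
    · rw [expCDF, if_pos h]
    · rw [expCDF, if_neg (by simp)]; norm_num
  have left : ∀ x y h, y ≤ 0 → x ≤ y → y ≤ x + h → 0 < h →
      Umap μ y - Umap μ x ≤ E₂ * cinv Hstar (t₀ ^ 2 + h) := by
    intro x y h hy hxy hyh hh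
    refine h2 (-Umap μ y) (neg_le_neg (hUm hy)) _ (sub_nonneg.2 (hUm hxy)) h hh (Real.exp y / 2)
      (by positivity) ?_ ?_
    · rw [map_measureReal_apply measurable_neg measurableSet_Ioi]
      have e : (fun x : ℝ => -x) ⁻¹' Ioi (-Umap μ y) = Iio (Umap μ y) := by
        ext z; simp
      rw [e]
      have := real_Iio_invCDF_le μ (expCDF_pos y) (expCDF_lt_one y)
      rw [← hexpn y hy]; exact this
    · rw [map_measureReal_apply measurable_neg measurableSet_Ici]
      have e : (fun x : ℝ => -x) ⁻¹' Ici (-Umap μ y + (Umap μ y - Umap μ x)) = Iic (Umap μ x) := by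
        ext z; simp
      rw [e]
      have h3 := le_cdf_invCDF μ (expCDF_lt_one x)
      rw [hexpn x (by linarith)] at h3
      have h4 : Real.exp y * Real.exp (-h) ≤ Real.exp x := by
        rw [← Real.exp_add]; exact Real.exp_le_exp.2 (by linarith)
      have h5 : Umap μ x = invCDF μ (Real.exp x / 2) := by
        rw [Umap, hexpn x (by linarith)]
      rw [h5]
      linarith
  refine ⟨1 / (E₁ + E₂), by positivity, fun h hh x => ?_⟩
  have hcn := HData.cinv_nonneg (Hstar := Hstar) (t₀ ^ 2 + h)
  rw [one_div_one_div, add_mul]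
  have n1 := mul_nonneg hE₁.le hcn
  have n2 := mul_nonneg hE₂.le hcn
  rcases le_total 0 x with hx | hx
  · have := right x (x + h) h hx (by linarith) le_rfl hh
    linarith
  rcases le_total (x + h) 0 with hy | hy
  · have := left x (x + h) h hy (by linarith) le_rfl hh
    linarith
  have r1 := right 0 (x + h) h le_rfl hy (by linarith) hh
  have r2 := left x 0 h le_rfl hx hy hh
  linarith

end Forward

/-- **Theorem 1.1 (main theorem).** For a symmetric convex `H` which is quadratic near the
origin, whose Fenchel–Legendre transform `H*` is superlinear, and which satisfies the scaling
condition `H(sx) ≤ A s^α H(x)`, a probability measure `μ` on the real line satisfies the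
convex log-Sobolev inequality (together with exponential integrability) if and only if
`Δ_μ(h) ≤ (1/b) θ⁻¹(t₀² + h)` for some `b > 0`, where `θ = H*`. -/
theorem convex_logSobolev_characterization
    (H : ℝ → ℝ) (t₀ : ℝ) (ht₀ : 0 < t₀)
    (hHnn : ∀ x, 0 ≤ H x)
    (hHsymm : ∀ x, H (-x) = H x)
    (hHconv : ConvexOn ℝ Set.univ H)
    (hHquad : ∀ x : ℝ, |x| ≤ 2 * t₀ → H x = x ^ 2 / 4)
    (Hstar : ℝ → ℝ)
    (hHstar : ∀ x, IsLUB (Set.range fun y => x * y - H y) (Hstar x))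
    (hsuper : Tendsto (fun x => Hstar x / x) atTop atTop)
    (A α : ℝ) (hA : 1 ≤ A) (hα₁ : 1 < α) (hα₂ : α ≤ 2)
    (hscale : ∀ x : ℝ, ∀ s ∈ Set.Icc (0:ℝ) 1, H (s * x) ≤ A * s ^ α * H x)
    (μ : Measure ℝ) [IsProbabilityMeasure μ] :
    ((∀ s > (0:ℝ), Integrable (fun x => Real.exp (s * |x|)) μ) ∧
      ∃ c > (0:ℝ), ∀ φ : ℝ → ℝ, ContDiff ℝ (⊤ : ℕ∞) φ → ConvexOn ℝ Set.univ φ →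
        (∃ K : ℝ≥0, LipschitzWith K φ) →
        Ent μ (fun x => Real.exp (φ x)) ≤
          ∫⁻ x, ENNReal.ofReal (H (c * deriv φ x) * Real.exp (φ x)) ∂μ)
    ↔
    (∃ b > (0:ℝ), ∀ h > (0:ℝ), ∀ x : ℝ,
      Umap μ (x + h) - Umap μ x ≤ (1 / b) * cinv Hstar (t₀ ^ 2 + h)) := by
  have D : HData H Hstar t₀ A α :=
    ⟨ht₀, hHnn, hHsymm, hHconv, hHquad, hHstar, hsuper, hA, hα₁, hα₂, hscale⟩
  constructor
  · rintro ⟨hexp, c, hc, hLS⟩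
    exact forward D μ hexp hc hLS
  · rintro ⟨b, hb, hU⟩
    exact ⟨backward_exp D μ hb hU, backward D μ hb hU⟩
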